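/- arXiv:1406.5675 — 2 statements merged into one kernel-verified Lean document; each statement's English description precedes it below -/
import Mathlib

section
/- Let K be an n×n real symmetric matrix, k a target rank, ε ∈ (0,1], and let μ_k be the matrix coherence of K relative to rank k. Form C = [C₁, C₂, C₃] as follows: C₁ consists of c₁ ≥ 20 μ_k k log(20k) columns of K sampled uniformly without replacement; C₂ consists of c₂ ≥ 17.5 k/ε columns of K drawn by adaptive sampling with respect to the residual K − C₁C₁†K; C₃ consists of c₃ ≥ 10 k/ε columns of K drawn by adaptive sampling with respect to the residual K − [C₁,C₂][C₁,C₂]†K. Then with probability at least 0.7 over the random sampling, ‖K − C C† K (C†)^T C^T‖_F ≤ (1 + ε) ‖K − K_k‖_F. -/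
open Matrix BigOperators
open scoped Classical

noncomputable section

/-- `B` satisfies the four Penrose conditions for `A`. -/
def IsMoorePenrose {m n : Type*} [Fintype m] [Fintype n]
    (A : Matrix m n ℝ) (B : Matrix n m ℝ) : Prop :=
  A * B * A = A ∧ B * A * B = B ∧ (A * B)ᵀ = A * B ∧ (B * A)ᵀ = B * A

/-- The Moore–Penrose pseudoinverse of a real matrix (defined via the unique
matrix satisfying the four Penrose conditions, which always exists). -/
def pinv {m n : Type*} [Fintype m] [Fintype n] (A : Matrix m n ℝ) : Matrix n m ℝ :=
  if h : ∃ B, IsMoorePenrose A B then h.choose else 0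

/-- Squared Frobenius norm. -/
def frobSq {m n : Type*} [Fintype m] [Fintype n] (A : Matrix m n ℝ) : ℝ :=
  ∑ i, ∑ j, (A i j) ^ 2

/-- Frobenius norm. -/
def frobNorm {m n : Type*} [Fintype m] [Fintype n] (A : Matrix m n ℝ) : ℝ :=
  Real.sqrt (frobSq A)

/-- Eigenvalues of a (hermitian) real matrix, sorted in descending order
(junk value `0` if the matrix is not hermitian). -/
def eigsDesc {n : ℕ} (A : Matrix (Fin n) (Fin n) ℝ) : Fin n → ℝ :=
  if hA : A.IsHermitian then
    fun i => hA.eigenvalues (Tuple.sort (fun j => -hA.eigenvalues j) i)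
  else 0

/-- Singular values of a real matrix, sorted in descending order. -/
def svalsDesc {m n : ℕ} (A : Matrix (Fin m) (Fin n) ℝ) : Fin n → ℝ :=
  fun i => Real.sqrt (eigsDesc (Aᵀ * A) i)

/-- Spectral norm (largest singular value). -/
def specNorm {m n : ℕ} (A : Matrix (Fin m) (Fin n) ℝ) : ℝ := ⨆ i, svalsDesc A i

/-- `Ak` is a best rank-`k` approximation of `A` in Frobenius norm. -/
def IsBestRankApprox {m n : Type*} [Fintype m] [Fintype n]
    (A Ak : Matrix m n ℝ) (k : ℕ) : Prop :=
  Ak.rank ≤ k ∧ ∀ X : Matrix m n ℝ, X.rank ≤ k → frobSq (A - Ak) ≤ frobSq (A - X)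

/-- `P` is a column selection matrix: each column is a distinct standard basis vector. -/
def IsColSelection {n c : ℕ} (P : Matrix (Fin n) (Fin c) ℝ) : Prop :=
  ∃ f : Fin c → Fin n, Function.Injective f ∧
    P = Matrix.of fun i j => if i = f j then 1 else 0

/-- Adaptive sampling probabilities for a residual matrix `B`
(uniform in the degenerate case `B = 0`). -/
def adaptP {m n : Type*} [Fintype m] [Fintype n] (B : Matrix m n ℝ) : n → ℝ :=
  fun j => if frobSq B = 0 then (Fintype.card n : ℝ)⁻¹ else (∑ i, (B i j) ^ 2) / frobSq B

/-- Uniform sampling matrix with entries `√(n/s)` at positions `(t j, j)`. -/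
def uSamp (n : ℕ) {s : ℕ} (t : Fin s → Fin n) : Matrix (Fin n) (Fin s) ℝ :=
  Matrix.of fun i j => if i = t j then Real.sqrt ((n : ℝ) / s) else 0

/-- Weighted sampling matrix with entries `1/√(s p i)` at positions `(t j, j)`. -/
def wSamp {n s : ℕ} (p : Fin n → ℝ) (t : Fin s → Fin n) : Matrix (Fin n) (Fin s) ℝ :=
  Matrix.of fun i j => if i = t j then 1 / Real.sqrt (s * p i) else 0

end


section PartA
variable {m n p : Type*} [Fintype m] [Fintype n] [Fintype p]

theorem frobSq_nonneg (A : Matrix m n ℝ) : 0 ≤ frobSq A :=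
  Finset.sum_nonneg fun _ _ => Finset.sum_nonneg fun _ _ => sq_nonneg _

theorem frobSq_eq_trace (A : Matrix m n ℝ) : frobSq A = (Aᵀ * A).trace := by
  simp only [frobSq, Matrix.trace, Matrix.diag, Matrix.mul_apply, Matrix.transpose_apply]
  rw [Finset.sum_comm]
  simp [sq]

theorem frobSq_transpose (A : Matrix m n ℝ) : frobSq Aᵀ = frobSq A := by
  simp only [frobSq, Matrix.transpose_apply]
  exact Finset.sum_comm

theorem frobSq_eq_zero {A : Matrix m n ℝ} (h : frobSq A = 0) : A = 0 := by
  ext i j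
  have h1 := (Finset.sum_eq_zero_iff_of_nonneg
    (fun i _ => Finset.sum_nonneg fun j _ => sq_nonneg (A i j))).1 h i (Finset.mem_univ _)
  have h2 := (Finset.sum_eq_zero_iff_of_nonneg
    (fun j _ => sq_nonneg (A i j))).1 h1 j (Finset.mem_univ _)
  simpa using h2

theorem frobSq_zero : frobSq (0 : Matrix m n ℝ) = 0 := by simp [frobSq]

theorem frobSq_add (A B : Matrix m n ℝ) :
    frobSq (A + B) = frobSq A + 2 * (Aᵀ * B).trace + frobSq B := by
  have h : (Bᵀ * A).trace = (Aᵀ * B).trace := by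
    rw [← Matrix.trace_transpose]; simp
  simp only [frobSq_eq_trace, Matrix.transpose_add, Matrix.add_mul, Matrix.mul_add,
    Matrix.trace_add, h]
  ring

/-- Pythagoras, orthogonality of column spaces. -/
theorem frobSq_add_of_left {A B : Matrix m n ℝ} (h : Aᵀ * B = 0) :
    frobSq (A + B) = frobSq A + frobSq B := by
  rw [frobSq_add, h]; simp

/-- Pythagoras, orthogonality of row spaces. -/
theorem frobSq_add_of_right {A B : Matrix m n ℝ} (h : A * Bᵀ = 0) :
    frobSq (A + B) = frobSq A + frobSq B := by
  rw [← frobSq_transpose (A + B), Matrix.transpose_add, frobSq_add_of_left, frobSq_transpose,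
    frobSq_transpose]
  simpa using h

theorem frobSq_add_le (A B : Matrix m n ℝ) :
    frobSq (A + B) ≤ 2 * frobSq A + 2 * frobSq B := by
  simp only [frobSq, Finset.mul_sum, ← Finset.sum_add_distrib]
  refine Finset.sum_le_sum fun i _ => Finset.sum_le_sum fun j _ => ?_
  simp only [Matrix.add_apply]
  nlinarith [sq_nonneg (A i j - B i j)]

theorem frobSq_mul_le (A : Matrix m n ℝ) (B : Matrix n p ℝ) :
    frobSq (A * B) ≤ frobSq A * frobSq B := by
  have h : ∀ i l, ((A * B) i l) ^ 2 ≤ (∑ j, (A i j) ^ 2) * ∑ j, (B j l) ^ 2 := by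
    intro i l
    rw [Matrix.mul_apply]
    exact Finset.sum_mul_sq_le_sq_mul_sq _ _ _
  calc frobSq (A * B) ≤ ∑ i, ∑ l, (∑ j, (A i j) ^ 2) * ∑ j, (B j l) ^ 2 :=
        Finset.sum_le_sum fun i _ => Finset.sum_le_sum fun l _ => h i l
    _ = frobSq A * frobSq B := by
        rw [frobSq, ← frobSq_transpose B, frobSq, Finset.sum_mul_sum]
        rfl

/-- Orthogonal projection matrices. -/
def IsOProj (P : Matrix m m ℝ) : Prop := Pᵀ = P ∧ P * P = P

theorem IsOProj.frobSq_eq {P : Matrix m m ℝ} (h : IsOProj P) : frobSq P = P.trace := by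
  rw [frobSq_eq_trace, h.1, h.2]

theorem IsOProj.diag_nonneg {P : Matrix m m ℝ} (h : IsOProj P) (i : m) : 0 ≤ P i i := by
  have : P i i = ∑ j, (P i j) ^ 2 := by
    conv_lhs => rw [← h.2]
    rw [Matrix.mul_apply]
    refine Finset.sum_congr rfl fun j _ => ?_
    have : P j i = P i j := congrFun (congrFun h.1 i) j
    rw [this, sq]
  rw [this]; exact Finset.sum_nonneg fun _ _ => sq_nonneg _

theorem IsOProj.diag_le_one {P : Matrix m m ℝ} (h : IsOProj P) (i : m) : P i i ≤ 1 := by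
  have h1 : P i i = ∑ j, (P i j) ^ 2 := by
    conv_lhs => rw [← h.2]
    rw [Matrix.mul_apply]
    refine Finset.sum_congr rfl fun j _ => ?_
    have : P j i = P i j := congrFun (congrFun h.1 i) j
    rw [this, sq]
  have h2 : (P i i) ^ 2 ≤ ∑ j, (P i j) ^ 2 :=
    Finset.single_le_sum (f := fun j => (P i j) ^ 2) (fun _ _ => sq_nonneg _) (Finset.mem_univ i)
  nlinarith

theorem IsOProj.trace_le {P : Matrix m m ℝ} (h : IsOProj P) : P.trace ≤ Fintype.card m := by
  calc P.trace ≤ ∑ _i : m, (1 : ℝ) := Finset.sum_le_sum fun i _ => h.diag_le_one i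
    _ = _ := by simp

/-- Best approximation property of projections. -/
theorem IsOProj.best {P : Matrix m m ℝ} (h : IsOProj P) (A Y : Matrix m n ℝ) (hY : P * Y = Y) :
    frobSq (A - P * A) ≤ frobSq (A - Y) := by
  have e : A - Y = (A - P * A) + P * (A - Y) := by
    rw [Matrix.mul_sub, hY]; abel
  rw [e, frobSq_add_of_left]
  · linarith [frobSq_nonneg (P * (A - Y))]
  · rw [Matrix.transpose_sub, Matrix.transpose_mul, h.1, Matrix.sub_mul, Matrix.mul_assoc Aᵀ P,
      ← Matrix.mul_assoc P P, h.2]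
    simp

theorem IsOProj.best_two {P : Matrix m m ℝ} (h : IsOProj P) (A Y : Matrix m m ℝ)
    (hY : P * Y = Y) (hY' : Y * P = Y) :
    frobSq (A - P * A * P) ≤ frobSq (A - Y) := by
  have e : A - Y = (A - P * A * P) + P * (A - Y) * P := by
    rw [Matrix.mul_sub, hY, Matrix.sub_mul, hY']; abel
  rw [e, frobSq_add]
  have : ((A - P * A * P)ᵀ * (P * (A - Y) * P)).trace = 0 := by
    rw [← Matrix.mul_assoc, Matrix.trace_mul_comm, ← Matrix.mul_assoc, ← Matrix.mul_assoc]
    have : P * (A - P * A * P)ᵀ * P = 0 := by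
      rw [Matrix.transpose_sub, Matrix.transpose_mul, Matrix.transpose_mul, h.1, Matrix.mul_sub,
        Matrix.sub_mul, ← Matrix.mul_assoc P P, h.2, Matrix.mul_assoc P _ P, Matrix.mul_assoc,
        Matrix.mul_assoc Aᵀ P P, h.2]
      simp
    rw [this]; simp
  rw [this]
  linarith [frobSq_nonneg (P * (A - Y) * P)]

theorem exists_spectral [DecidableEq n] (A : Matrix n n ℝ) (hA : A.IsHermitian) :
    ∃ U : Matrix n n ℝ, Uᵀ * U = 1 ∧ U * Uᵀ = 1 ∧ A = U * diagonal hA.eigenvalues * Uᵀ := by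
  refine ⟨hA.eigenvectorUnitary, ?_, ?_, ?_⟩
  · have := Unitary.coe_star_mul_self hA.eigenvectorUnitary
    simpa [Matrix.star_eq_conjTranspose] using this
  · have := Unitary.coe_mul_star_self hA.eigenvectorUnitary
    simpa [Matrix.star_eq_conjTranspose] using this
  · have := hA.spectral_theorem
    rw [Unitary.conjStarAlgAut_apply] at this
    simpa [Matrix.star_eq_conjTranspose, Function.comp_def] using this

theorem exists_moorePenrose (A : Matrix m n ℝ) : ∃ B, IsMoorePenrose A B := by
  have hG : (Aᵀ * A).IsHermitian := by
    have := Matrix.isHermitian_conjTranspose_mul_self A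
    simpa using this
  obtain ⟨U, hU1, hU2, hGe⟩ := exists_spectral _ hG
  set l := hG.eigenvalues
  set G := Aᵀ * A with hGdef
  set H := U * diagonal (fun i => (l i)⁻¹) * Uᵀ with hH
  have key : ∀ a b : n → ℝ, (U * diagonal a * Uᵀ) * (U * diagonal b * Uᵀ)
      = U * diagonal (fun i => a i * b i) * Uᵀ := by
    intro a b
    calc _ = U * diagonal a * (Uᵀ * U) * diagonal b * Uᵀ := by simp only [Matrix.mul_assoc]
      _ = _ := by rw [hU1, Matrix.mul_one, Matrix.mul_assoc U, Matrix.diagonal_mul_diagonal]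
  have keyT : ∀ a : n → ℝ, (U * diagonal a * Uᵀ)ᵀ = U * diagonal a * Uᵀ := by
    intro a; simp [Matrix.mul_assoc]
  have hGHG : G * H * G = G := by
    rw [hH, hGe, key, key]
    congr 3; ext i
    by_cases h : l i = 0 <;> simp [h]
  have hHGH : H * G * H = H := by
    rw [hH, hGe, key, key]
    congr 3; ext i
    by_cases h : l i = 0 <;> simp [h]
  have hHT : Hᵀ = H := keyT _
  have hGT : Gᵀ = G := by simp [hGdef]
  have hHG : (H * G)ᵀ = H * G := by
    rw [hH, hGe, key, keyT]
  have hA1 : A * (H * G) = A := by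
    have : frobSq (A * (H * G) - A) = 0 := by
      rw [frobSq_eq_trace, Matrix.transpose_sub, Matrix.transpose_mul, hHG]
      have : (H * G * Aᵀ - Aᵀ) * (A * (H * G) - A) = 0 := by
        calc (H * G * Aᵀ - Aᵀ) * (A * (H * G) - A)
            = H * (G * (Aᵀ * A) * H * G) - H * G * (Aᵀ * A) - ((Aᵀ * A) * H * G - Aᵀ * A) := by
              simp only [Matrix.sub_mul, Matrix.mul_sub, Matrix.mul_assoc]
              abel
          _ = H * (G * (G * H * G)) - H * G * G - (G * H * G - G) := by
              rw [← hGdef]; simp only [Matrix.mul_assoc]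
          _ = 0 := by rw [hGHG]; simp [Matrix.mul_assoc]
      rw [this]; simp
    exact sub_eq_zero.1 (frobSq_eq_zero this)
  refine ⟨H * Aᵀ, ?_, ?_, ?_, ?_⟩
  · rw [← Matrix.mul_assoc, Matrix.mul_assoc, Matrix.mul_assoc, ← hGdef]; exact hA1
  · calc H * Aᵀ * A * (H * Aᵀ) = H * (Aᵀ * A) * H * Aᵀ := by simp only [Matrix.mul_assoc]
      _ = H * Aᵀ := by rw [← hGdef, hHGH]
  · simp [hHT, Matrix.mul_assoc]
  · rw [Matrix.mul_assoc, ← hGdef]; exact hHG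

theorem pinv_spec (A : Matrix m n ℝ) : IsMoorePenrose A (pinv A) := by
  have h := exists_moorePenrose A
  rw [pinv, dif_pos h]
  exact h.choose_spec

theorem isOProj_left (A : Matrix m n ℝ) : IsOProj (A * pinv A) := by
  obtain ⟨h1, h2, h3, h4⟩ := pinv_spec A
  exact ⟨h3, by rw [← Matrix.mul_assoc, h1]⟩

theorem isOProj_right (A : Matrix m n ℝ) : IsOProj (pinv A * A) := by
  obtain ⟨h1, h2, h3, h4⟩ := pinv_spec A
  exact ⟨h4, by rw [← Matrix.mul_assoc, h2]⟩

theorem proj_mul_self (A : Matrix m n ℝ) : A * pinv A * A = A := (pinv_spec A).1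

theorem IsOProj.trace_eq_rank [DecidableEq m] {P : Matrix m m ℝ} (h : IsOProj P) : P.trace = P.rank := by
  have hp : IsIdempotentElem (Matrix.toLin' P) := by
    unfold IsIdempotentElem
    rw [Module.End.mul_eq_comp, ← Matrix.toLin'_mul, h.2]
  have := (LinearMap.IsIdempotentElem.isProj_range _ hp).trace
  rw [Matrix.trace_toLin'_eq] at this
  rw [this]; rfl

end PartA


theorem sum_castLE {n k : ℕ} (hkn : k ≤ n) (f : Fin n → ℝ) :
    ∑ i : Fin k, f (Fin.castLE hkn i) = ∑ i : Fin n, if (i : ℕ) < k then f i else 0 := by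
  rw [← Finset.sum_filter]
  have : (Finset.univ.filter fun i : Fin n => (i : ℕ) < k) =
      Finset.univ.map (Fin.castLEEmb hkn) := by
    ext i
    simp only [Finset.mem_filter, Finset.mem_univ, true_and, Finset.mem_map]
    constructor
    · intro h; exact ⟨⟨i, h⟩, by ext; simp⟩
    · rintro ⟨j, rfl⟩; simp
  rw [this, Finset.sum_map]
  rfl

theorem ky_fan_weights {n k : ℕ} (hk : 0 < k) (hkn : k ≤ n) (lam w : Fin n → ℝ)
    (hanti : Antitone lam) (hnn : ∀ i, 0 ≤ lam i) (hw0 : ∀ i, 0 ≤ w i) (hw1 : ∀ i, w i ≤ 1)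
    (hw : ∑ i, w i ≤ k) :
    ∑ i, lam i * w i ≤ ∑ i : Fin k, lam (Fin.castLE hkn i) := by
  set a : Fin n := ⟨k - 1, by omega⟩ with ha
  have hone : ∑ i : Fin n, (if (i : ℕ) < k then (1 : ℝ) else 0) = k := by
    rw [← sum_castLE hkn (fun _ => 1)]; simp
  rw [sum_castLE]
  have h1 : ∀ i, lam i * w i - (if (i : ℕ) < k then lam i else 0) ≤
      lam a * (w i - if (i : ℕ) < k then 1 else 0) := by
    intro i
    split_ifs with h
    · have : lam a ≤ lam i := hanti (by rw [Fin.le_def]; simp only [ha]; omega)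
      nlinarith [hw1 i]
    · have : lam i ≤ lam a := hanti (by rw [Fin.le_def]; simp only [ha]; omega)
      nlinarith [hw0 i]
  have h2 := Finset.sum_le_sum fun i (_ : i ∈ Finset.univ) => h1 i
  rw [Finset.sum_sub_distrib, ← Finset.mul_sum, Finset.sum_sub_distrib, hone] at h2
  nlinarith [hnn a]

theorem trace_proj_le {n k : ℕ} (hk : 0 < k) (hkn : k ≤ n) (K P : Matrix (Fin n) (Fin n) ℝ)
    (hP : IsOProj P) (htr : P.trace ≤ k) :
    (Kᵀ * K * P).trace ≤ ∑ i : Fin k, (svalsDesc K (Fin.castLE hkn i)) ^ 2 := by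
  have hG : (Kᵀ * K).IsHermitian := by
    simpa using Matrix.isHermitian_conjTranspose_mul_self K
  have hpsd : (Kᵀ * K).PosSemidef := by
    simpa using Matrix.posSemidef_conjTranspose_mul_self K
  have hnn : ∀ i, 0 ≤ hG.eigenvalues i := hpsd.eigenvalues_nonneg
  obtain ⟨U, hU1, hU2, hGe⟩ := exists_spectral _ hG
  set l := hG.eigenvalues
  set s := Tuple.sort (fun j => -l j) with hs
  have hanti : Antitone (fun i => l (s i)) := by
    intro i j hij
    have := Tuple.monotone_sort (fun j => -l j) hij
    simpa [← hs] using this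
  have hsv : ∀ i, (svalsDesc K i) ^ 2 = l (s i) := by
    intro i
    have : eigsDesc (Kᵀ * K) i = l (s i) := by
      rw [eigsDesc, dif_pos hG]
    rw [svalsDesc, this, Real.sq_sqrt (hnn _)]
  simp only [hsv]
  set R := Uᵀ * P * U with hR
  have hRp : IsOProj R := by
    constructor
    · simp [hR, hP.1, Matrix.mul_assoc]
    · calc R * R = Uᵀ * P * (U * Uᵀ) * P * U := by simp only [hR, Matrix.mul_assoc]
        _ = Uᵀ * (P * P) * U := by rw [hU2, Matrix.mul_one]; simp only [Matrix.mul_assoc]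
        _ = R := by rw [hP.2]
  have hRtr : R.trace = P.trace := by
    rw [hR, Matrix.trace_mul_comm, ← Matrix.mul_assoc, hU2, Matrix.one_mul]
  have h1 : (Kᵀ * K * P).trace = ∑ i, l i * R i i := by
    rw [hGe]
    have : (U * diagonal l * Uᵀ * P).trace = (diagonal l * R).trace := by
      rw [Matrix.mul_assoc, Matrix.mul_assoc, Matrix.trace_mul_comm, hR]
      simp only [Matrix.mul_assoc]
    rw [this, Matrix.trace]
    simp [Matrix.diagonal_mul]
  rw [h1, ← Equiv.sum_comp s]
  refine ky_fan_weights hk hkn (fun i => l (s i)) (fun i => R (s i) (s i)) hanti (fun _ => hnn _)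
    (fun _ => hRp.diag_nonneg _) (fun _ => hRp.diag_le_one _) ?_
  rw [Equiv.sum_comp s (fun i => R i i)]
  calc _ = R.trace := rfl
    _ ≤ k := by rw [hRtr]; exact htr

theorem eckart_young {n k : ℕ} (hk : 0 < k) (hkn : k ≤ n)
    (K X : Matrix (Fin n) (Fin n) ℝ)
    (Vk : Matrix (Fin n) (Fin k) ℝ) (hV1 : Vkᵀ * Vk = 1)
    (hV2 : Kᵀ * K * Vk =
      Vk * Matrix.diagonal (fun i : Fin k => (svalsDesc K (Fin.castLE hkn i)) ^ 2))
    (hX : X.rank ≤ k) :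
    frobSq (K - K * Vk * Vkᵀ) ≤ frobSq (K - X) := by
  have pyth : ∀ P : Matrix (Fin n) (Fin n) ℝ, IsOProj P →
      frobSq (K - K * P) = frobSq K - (Kᵀ * K * P).trace := by
    intro P hP
    have h0 : frobSq ((K - K * P) + K * P) = frobSq (K - K * P) + frobSq (K * P) := by
      apply frobSq_add_of_right
      rw [Matrix.transpose_mul, hP.1, Matrix.sub_mul, Matrix.mul_assoc K P, ← Matrix.mul_assoc P P,
        hP.2]
      simp
    have h1 : frobSq (K * P) = (Kᵀ * K * P).trace := by
      rw [frobSq_eq_trace, Matrix.transpose_mul, hP.1, Matrix.mul_assoc, Matrix.trace_mul_comm]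
      have : Kᵀ * (K * P) * P = Kᵀ * K * (P * P) := by simp only [Matrix.mul_assoc]
      rw [this, hP.2]
    rw [sub_add_cancel, h1] at h0
    linarith
  have hVp : IsOProj (Vk * Vkᵀ) := by
    constructor
    · simp
    · rw [Matrix.mul_assoc, ← Matrix.mul_assoc Vkᵀ, hV1, Matrix.one_mul]
  set P := pinv X * X with hPdef
  have hP : IsOProj P := isOProj_right X
  have htr : P.trace ≤ k := by
    rw [hP.trace_eq_rank]
    exact_mod_cast (Matrix.rank_mul_le_right _ _).trans hX
  have h1 := trace_proj_le hk hkn K P hP htr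
  have h2 : (Kᵀ * K * (Vk * Vkᵀ)).trace = ∑ i : Fin k, (svalsDesc K (Fin.castLE hkn i)) ^ 2 := by
    rw [← Matrix.mul_assoc, hV2, Matrix.trace_mul_comm, ← Matrix.mul_assoc, hV1, Matrix.one_mul,
      Matrix.trace_diagonal]
  have h3 : frobSq (K - K * P) ≤ frobSq (K - X) := by
    have := hP.best Kᵀ Xᵀ (by
      have := congrArg Matrix.transpose (proj_mul_self X)
      rw [Matrix.mul_assoc, ← hPdef, Matrix.transpose_mul, hP.1] at this
      exact this)
    rw [← frobSq_transpose, ← frobSq_transpose (K - X)]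
    simpa [hP.1] using this
  have h4 := pyth _ hVp
  have h5 := pyth _ hP
  rw [Matrix.mul_assoc K]
  linarith


/-- Expectation over `c` i.i.d. draws from `p`. -/
noncomputable def Ew {n : ℕ} (p : Fin n → ℝ) (c : ℕ) (f : (Fin c → Fin n) → ℝ) : ℝ :=
  ∑ t : Fin c → Fin n, (∏ j, p (t j)) * f t

section PartC
variable {n : ℕ} {p : Fin n → ℝ} {c : ℕ}

theorem Ew_zero (f : (Fin 0 → Fin n) → ℝ) : Ew p 0 f = f Fin.elim0 := by
  simp only [Ew, Finset.univ_unique, Finset.univ_eq_empty, Finset.prod_empty, one_mul,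
    Finset.sum_singleton]
  congr 1

theorem Ew_succ (f : (Fin (c + 1) → Fin n) → ℝ) :
    Ew p (c + 1) f = ∑ i, p i * Ew p c (fun t => f (Fin.cons i t)) := by
  simp only [Ew, Finset.mul_sum]
  rw [← (Fin.consEquiv (fun _ => Fin n)).sum_comp, Fintype.sum_prod_type]
  refine Finset.sum_congr rfl fun i _ => Finset.sum_congr rfl fun t _ => ?_
  simp [Fin.consEquiv, Fin.prod_univ_succ, mul_assoc]

theorem Ew_add (f g : (Fin c → Fin n) → ℝ) :
    Ew p c (fun t => f t + g t) = Ew p c f + Ew p c g := by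
  simp only [Ew, mul_add, Finset.sum_add_distrib]

theorem Ew_mul (a : ℝ) (f : (Fin c → Fin n) → ℝ) :
    Ew p c (fun t => a * f t) = a * Ew p c f := by
  simp only [Ew, Finset.mul_sum]
  exact Finset.sum_congr rfl fun t _ => by ring

theorem Ew_sum {ι : Type*} (s : Finset ι) (f : ι → (Fin c → Fin n) → ℝ) :
    Ew p c (fun t => ∑ i ∈ s, f i t) = ∑ i ∈ s, Ew p c (f i) := by
  simp only [Ew, Finset.mul_sum]
  exact Finset.sum_comm

theorem Ew_mono (hp : ∀ i, 0 ≤ p i) {f g : (Fin c → Fin n) → ℝ} (h : ∀ t, f t ≤ g t) :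
    Ew p c f ≤ Ew p c g :=
  Finset.sum_le_sum fun t _ => mul_le_mul_of_nonneg_left (h t)
    (Finset.prod_nonneg fun _ _ => hp _)

theorem Ew_const (hp1 : ∑ i, p i = 1) (a : ℝ) : Ew p c (fun _ => a) = a := by
  induction c with
  | zero => rw [Ew_zero]
  | succ c ih => rw [Ew_succ]; simp only [ih]; rw [← Finset.sum_mul, hp1, one_mul]

theorem Ew_sq (hp1 : ∑ i, p i = 1) (y : Fin n → ℝ) (hy : ∑ i, p i * y i = 0) (x : ℝ) :
    Ew p c (fun t => (x + ∑ l, y (t l)) ^ 2) = x ^ 2 + c * ∑ i, p i * (y i) ^ 2 := by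
  induction c generalizing x with
  | zero => rw [Ew_zero]; simp
  | succ c ih =>
    rw [Ew_succ]
    have : ∀ i, Ew p c (fun t => (x + ∑ l, y ((Fin.cons i t : Fin (c + 1) → Fin n) l)) ^ 2)
        = (x + y i) ^ 2 + c * ∑ i, p i * (y i) ^ 2 := by
      intro i
      rw [← ih (x + y i)]
      congr 1; ext t
      rw [Fin.sum_univ_succ]
      simp [add_assoc]
    simp only [this]
    set S := ∑ i, p i * (y i) ^ 2
    have : ∀ i, p i * ((x + y i) ^ 2 + c * S) =
        (x ^ 2 + c * S) * p i + 2 * x * (p i * y i) + p i * (y i) ^ 2 := by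
      intro i; ring
    simp only [this, Finset.sum_add_distrib, ← Finset.mul_sum]
    rw [hp1, hy]; push_cast; ring

theorem Ew_var (hp1 : ∑ i, p i = 1) (hc : 0 < c) (z : Fin n → ℝ) (m : ℝ)
    (hm : ∑ i, p i * z i = m) :
    Ew p c (fun t => (m - ∑ l, (c : ℝ)⁻¹ * z (t l)) ^ 2) ≤ (c : ℝ)⁻¹ * ∑ i, p i * (z i) ^ 2 := by
  have hc' : (c : ℝ) ≠ 0 := by positivity
  have h1 : ∀ t : Fin c → Fin n, (m - ∑ l, (c : ℝ)⁻¹ * z (t l)) ^ 2 =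
      ((c : ℝ)⁻¹) ^ 2 * (0 + ∑ l, (m - z (t l))) ^ 2 := by
    intro t
    rw [Finset.sum_sub_distrib, ← Finset.mul_sum]
    simp only [Finset.sum_const, Finset.card_univ, Fintype.card_fin, nsmul_eq_mul]
    field_simp
    ring
  simp only [h1]
  rw [Ew_mul, Ew_sq hp1 (fun i => m - z i)]
  · have h2 : ∑ i, p i * (m - z i) ^ 2 = (∑ i, p i * (z i) ^ 2) - m ^ 2 := by
      have : ∀ i, p i * (m - z i) ^ 2 = m ^ 2 * p i - 2 * m * (p i * z i) + p i * (z i) ^ 2 := by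
        intro i; ring
      simp only [this, Finset.sum_add_distrib, Finset.sum_sub_distrib, ← Finset.mul_sum]
      rw [hm, hp1]; ring
    rw [h2]
    have h3 : ((c : ℝ)⁻¹) ^ 2 * (0 ^ 2 + c * ((∑ i, p i * (z i) ^ 2) - m ^ 2)) =
        (c : ℝ)⁻¹ * ((∑ i, p i * (z i) ^ 2) - m ^ 2) := by
      field_simp; ring
    rw [h3]
    apply mul_le_mul_of_nonneg_left _ (by positivity)
    nlinarith [sq_nonneg m]
  · simp only [mul_sub, Finset.sum_sub_distrib, ← Finset.sum_mul]
    rw [hm, hp1]; ring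

theorem markov_fin {Ω : Type*} [Fintype Ω] (q D : Ω → ℝ) (hq : ∀ w, 0 ≤ q w) (hq1 : ∑ w, q w = 1)
    (hD : ∀ w, 0 ≤ D w) (a θ : ℝ) (hθ : 0 ≤ θ) (h : ∑ w, q w * D w ≤ a * θ)
    (ha : 0 ≤ a) :
    1 - a ≤ ∑ w, if D w ≤ θ then q w else 0 := by
  rcases hθ.eq_or_lt with h0 | h0
  · have hz : ∑ w, q w * D w = 0 :=
      le_antisymm (by rw [← h0] at h; simpa using h)
        (Finset.sum_nonneg fun w _ => mul_nonneg (hq w) (hD w))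
    have hz' := (Finset.sum_eq_zero_iff_of_nonneg fun w _ => mul_nonneg (hq w) (hD w)).1 hz
    have : ∑ w, (if D w ≤ θ then q w else 0) = ∑ w, q w := by
      refine Finset.sum_congr rfl fun w _ => ?_
      split_ifs with hh
      · rfl
      · rcases mul_eq_zero.1 (hz' w (Finset.mem_univ _)) with h1 | h1
        · exact h1.symm
        · exact absurd (by rw [h1]; exact hθ) hh
    rw [this, hq1]; linarith
  · have h1 : ∀ w, θ * q w - q w * D w ≤ θ * (if D w ≤ θ then q w else 0) := by
      intro w
      split_ifs with hh
      · nlinarith [mul_nonneg (hq w) (hD w)]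
      · push Not at hh
        nlinarith [hq w]
    have h2 := Finset.sum_le_sum fun w (_ : w ∈ Finset.univ) => h1 w
    rw [Finset.sum_sub_distrib, ← Finset.mul_sum, ← Finset.mul_sum, hq1] at h2
    have h3 : θ * (1 - a) ≤ θ * ∑ w, (if D w ≤ θ then q w else 0) := by linarith
    exact le_of_mul_le_mul_left h3 h0

/-- The Monte-Carlo estimator of `B * G`. -/
noncomputable def Zhat {m d : Type*} (B : Matrix m (Fin n) ℝ) (p : Fin n → ℝ)
    (G : Matrix (Fin n) d ℝ) (t : Fin c → Fin n) : Matrix m d ℝ :=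
  B.submatrix id t * Matrix.of fun l b => (c : ℝ)⁻¹ * (G (t l) b / p (t l))

theorem adaptP_nonneg {m : Type*} [Fintype m] (B : Matrix m (Fin n) ℝ) (j : Fin n) :
    0 ≤ adaptP B j := by
  unfold adaptP
  split_ifs
  · positivity
  · exact div_nonneg (Finset.sum_nonneg fun _ _ => sq_nonneg _) (frobSq_nonneg _)

theorem adaptP_sum {m : Type*} [Fintype m] (hn : 0 < n) (B : Matrix m (Fin n) ℝ) :
    ∑ j, adaptP B j = 1 := by
  unfold adaptP
  by_cases h : frobSq B = 0
  · simp only [h, if_true]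
    simp
    field_simp
  · simp only [h, if_false]
    rw [← Finset.sum_div, Finset.sum_comm]
    exact div_self h

theorem adaptive_var {m d : Type*} [Fintype m] [Fintype d] (hn : 0 < n) (hc : 0 < c)
    (B : Matrix m (Fin n) ℝ) (G : Matrix (Fin n) d ℝ) :
    Ew (adaptP B) c (fun t => frobSq (B * G - Zhat B (adaptP B) G t)) ≤
      (c : ℝ)⁻¹ * (frobSq B * frobSq G) := by
  set p := adaptP B with hp
  have hp1 : ∑ j, p j = 1 := adaptP_sum hn B
  have hcol : ∀ j, ∑ a, (B a j) ^ 2 = p j * frobSq B := by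
    intro j
    simp only [hp, adaptP]
    split_ifs with h
    · rw [h, mul_zero, frobSq_eq_zero h]; simp
    · field_simp
  have hz : ∀ j, p j = 0 → ∀ a, B a j = 0 := by
    intro j hj a
    have h := hcol j
    rw [hj, zero_mul] at h
    have := (Finset.sum_eq_zero_iff_of_nonneg (fun a _ => sq_nonneg (B a j))).1 h a
      (Finset.mem_univ _)
    simpa using this
  have hmean : ∀ a b, ∑ j, p j * (B a j * (G j b / p j)) = (B * G) a b := by
    intro a b
    rw [Matrix.mul_apply]
    refine Finset.sum_congr rfl fun j _ => ?_
    by_cases h : p j = 0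
    · simp [hz j h a]
    · field_simp
  have hent : ∀ (t : Fin c → Fin n) a b, (B * G - Zhat B p G t) a b =
      (B * G) a b - ∑ l, (c : ℝ)⁻¹ * (B a (t l) * (G (t l) b / p (t l))) := by
    intro t a b
    rw [Matrix.sub_apply]
    congr 1
    rw [Zhat, Matrix.mul_apply]
    refine Finset.sum_congr rfl fun l _ => ?_
    simp only [Matrix.submatrix_apply, id, Matrix.of_apply]
    ring
  simp only [frobSq, hent]
  rw [Ew_sum]
  simp only [Ew_sum (p := p) (c := c)]
  refine le_trans (Finset.sum_le_sum fun a _ => Finset.sum_le_sum fun b _ =>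
          Ew_var hp1 hc (fun j => B a j * (G j b / p j)) _ (hmean a b)) ?_
  calc ∑ a, ∑ b, (c : ℝ)⁻¹ * ∑ j, p j * (B a j * (G j b / p j)) ^ 2
      = (c : ℝ)⁻¹ * ∑ j, ∑ a, ∑ b, p j * (B a j * (G j b / p j)) ^ 2 := by
        simp only [Finset.mul_sum]
        symm
        rw [Finset.sum_comm]
        exact Finset.sum_congr rfl fun a _ => Finset.sum_comm
    _ ≤ (c : ℝ)⁻¹ * ∑ j, frobSq B * ∑ b, (G j b) ^ 2 := by
        apply mul_le_mul_of_nonneg_left _ (by positivity)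
        refine Finset.sum_le_sum fun j _ => ?_
        have e : ∑ a, ∑ b, p j * (B a j * (G j b / p j)) ^ 2 =
            (p j / (p j) ^ 2) * ((∑ a, (B a j) ^ 2) * ∑ b, (G j b) ^ 2) := by
          rw [Finset.sum_mul_sum, Finset.mul_sum]
          refine Finset.sum_congr rfl fun a _ => ?_
          rw [Finset.mul_sum]
          refine Finset.sum_congr rfl fun b _ => ?_
          ring
        rw [e, hcol]
        by_cases h : p j = 0
        · rw [h]; simp
          exact mul_nonneg (frobSq_nonneg B) (Finset.sum_nonneg fun _ _ => sq_nonneg _)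
        · apply le_of_eq; field_simp
    _ = _ := by rw [← Finset.mul_sum]; rfl

end PartC


/-- Projection onto the span of the selected columns. -/
noncomputable def PJ {n : ℕ} (K : Matrix (Fin n) (Fin n) ℝ) {ι : Type} [Fintype ι]
    (s : ι → Fin n) : Matrix (Fin n) (Fin n) ℝ :=
  K.submatrix id s * pinv (K.submatrix id s)

/-- Residual after projecting onto the span of the selected columns. -/
noncomputable def resK {n : ℕ} (K : Matrix (Fin n) (Fin n) ℝ) {ι : Type} [Fintype ι]
    (s : ι → Fin n) : Matrix (Fin n) (Fin n) ℝ :=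
  K - PJ K s * K

section PartD
variable {n : ℕ} (K : Matrix (Fin n) (Fin n) ℝ)
variable {ι ι' : Type} [Fintype ι] [Fintype ι']

theorem IsOProj.orth {Q : Matrix (Fin n) (Fin n) ℝ} (h : IsOProj Q)
    (A B : Matrix (Fin n) (Fin n) ℝ) : (A - Q * A)ᵀ * (Q * B) = 0 := by
  rw [Matrix.transpose_sub, Matrix.transpose_mul, h.1, Matrix.sub_mul,
    Matrix.mul_assoc, ← Matrix.mul_assoc Q Q, h.2]
  simp

theorem PJ_proj (s : ι → Fin n) : IsOProj (PJ K s) := isOProj_left _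

theorem mul_submatrix_col {ι : Type} (A : Matrix (Fin n) (Fin n) ℝ) (s : ι → Fin n) :
    A * K.submatrix id s = (A * K).submatrix id s := by
  ext a j; simp [Matrix.mul_apply]

theorem PJ_col (s : ι → Fin n) (a : Fin n) (j : ι) : (PJ K s * K) a (s j) = K a (s j) := by
  have h := proj_mul_self (K.submatrix id s)
  change PJ K s * K.submatrix id s = _ at h
  rw [mul_submatrix_col] at h
  exact congrFun (congrFun h a) j

theorem PJ_mul_submatrix (s : ι → Fin n) (s' : ι' → Fin n) (h : ∀ j, ∃ j', s' j' = s j) :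
    PJ K s' * K.submatrix id s = K.submatrix id s := by
  rw [mul_submatrix_col]
  ext a j
  obtain ⟨j', hj⟩ := h j
  simp only [Matrix.submatrix_apply, id, ← hj, PJ_col]

theorem PJ_mul_PJ (s : ι → Fin n) (s' : ι' → Fin n) (h : ∀ j, ∃ j', s' j' = s j) :
    PJ K s' * PJ K s = PJ K s := by
  conv_lhs => rw [PJ.eq_def K s]
  rw [← Matrix.mul_assoc, PJ_mul_submatrix K s s' h]; rfl

theorem res_antitone (s : ι → Fin n) (s' : ι' → Fin n) (h : ∀ j, ∃ j', s' j' = s j) :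
    frobSq (resK K s') ≤ frobSq (resK K s) :=
  (PJ_proj K s').best K _ (by rw [← Matrix.mul_assoc, PJ_mul_PJ K s s' h])

theorem PJ_mul_Zhat {c : ℕ} {d : Type} (s : ι → Fin n) (t : Fin c → Fin n) (s' : ι' → Fin n)
    (h : ∀ j, ∃ j', s' j' = s j) (h' : ∀ j, ∃ j', s' j' = t j) (p : Fin n → ℝ)
    (G : Matrix (Fin n) d ℝ) :
    PJ K s' * Zhat (resK K s) p G t = Zhat (resK K s) p G t := by
  have e : (resK K s).submatrix id t = K.submatrix id t - PJ K s * K.submatrix id t := by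
    rw [mul_submatrix_col]; rfl
  rw [Zhat, ← Matrix.mul_assoc]
  congr 1
  rw [e, Matrix.mul_sub, ← Matrix.mul_assoc, PJ_mul_PJ K s s' h, PJ_mul_submatrix K t s' h']

theorem stage23 {k c₁ c₂ c₃ : ℕ} (hn : 0 < n) (hc₂ : 0 < c₂) (hc₃ : 0 < c₃) (hK : Kᵀ = K)
    (ε OPT : ℝ) (hε : 0 < ε) (hε1 : ε ≤ 1) (hO : 0 ≤ OPT)
    (V : Matrix (Fin n) (Fin k) ℝ) (hV : Vᵀ * V = 1)
    (hVO : frobSq (K - K * V * Vᵀ) ≤ OPT)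
    (h2 : (c₂ : ℝ)⁻¹ * k ≤ ε / 17.5) (h3 : (c₃ : ℝ)⁻¹ * k ≤ ε / 10)
    (t₁ : Fin c₁ → Fin n) (a : ℝ) (ha0 : 0 ≤ a)
    (ha : ε * (frobSq (resK K t₁) * (1.1 / 17.5) + OPT / 10) ≤ a * ((2 * ε + ε ^ 2) * OPT)) :
    1 - a ≤ ∑ w : (Fin c₂ → Fin n) × (Fin c₃ → Fin n),
      if frobSq (K - PJ K (Sum.elim t₁ (Sum.elim w.1 w.2)) * K *
          PJ K (Sum.elim t₁ (Sum.elim w.1 w.2))) ≤ (1 + ε) ^ 2 * OPT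
      then (∏ j, adaptP (resK K t₁) (w.1 j)) *
        ∏ j, adaptP (resK K (Sum.elim t₁ w.1)) (w.2 j) else 0 := by
  set p := adaptP (resK K t₁) with hp
  let p2 : (Fin c₂ → Fin n) → Fin n → ℝ := fun t => adaptP (resK K (Sum.elim t₁ t))
  have hp0 : ∀ j, 0 ≤ p j := adaptP_nonneg _
  have hp1 : ∑ j, p j = 1 := adaptP_sum hn _
  have hp20 : ∀ t j, 0 ≤ p2 t j := fun t => adaptP_nonneg _
  have hp21 : ∀ t, ∑ j, p2 t j = 1 := fun t => adaptP_sum hn _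
  set r := frobSq (resK K t₁) with hr
  let W : (Fin c₂ → Fin n) → Matrix (Fin n) (Fin k) ℝ := fun t =>
    PJ K t₁ * K * V + Zhat (resK K t₁) p V t
  let D2 : (Fin c₂ → Fin n) → ℝ := fun t => frobSq (K * V - W t)
  let Q : (Fin c₂ → Fin n) → Matrix (Fin n) (Fin n) ℝ := fun t => W t * pinv (W t)
  have hQ : ∀ t, IsOProj (Q t) := fun t => isOProj_left _
  have hQk : ∀ t, frobSq (Q t) ≤ k := by
    intro t
    rw [(hQ t).frobSq_eq]
    change (W t * pinv (W t)).trace ≤ k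
    rw [Matrix.trace_mul_comm]
    simpa using (isOProj_right (W t)).trace_le
  let W3 : (Fin c₂ → Fin n) → (Fin c₃ → Fin n) → Matrix (Fin n) (Fin n) ℝ := fun t u =>
    PJ K (Sum.elim t₁ t) * K * Q t + Zhat (resK K (Sum.elim t₁ t)) (p2 t) (Q t) u
  let D3 : (Fin c₂ → Fin n) → (Fin c₃ → Fin n) → ℝ := fun t u => frobSq (K * Q t - W3 t u)
  have hD2n : ∀ t, 0 ≤ D2 t := fun t => frobSq_nonneg _
  have hD3n : ∀ t u, 0 ≤ D3 t u := fun t u => frobSq_nonneg _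
  have hVk : frobSq V = k := by rw [frobSq_eq_trace, hV]; simp
  have hED2 : Ew p c₂ D2 ≤ (c₂ : ℝ)⁻¹ * (r * k) := by
    have := adaptive_var (c := c₂) hn hc₂ (resK K t₁) V
    rw [hVk] at this
    refine le_trans (le_of_eq ?_) this
    congr 1; ext t
    simp only [D2, W, resK, Matrix.sub_mul]
    congr 1
    abel
  have hWV : ∀ t, frobSq (K - W t * Vᵀ) ≤ OPT + D2 t := by
    intro t
    have e : K - W t * Vᵀ = (K - K * V * Vᵀ) + (K * V - W t) * Vᵀ := by
      rw [Matrix.sub_mul]; abel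
    rw [e, frobSq_add_of_right]
    · have : frobSq ((K * V - W t) * Vᵀ) = D2 t := by
        rw [← frobSq_transpose, frobSq_eq_trace, Matrix.transpose_transpose, Matrix.transpose_mul,
          Matrix.transpose_transpose, Matrix.mul_assoc, ← Matrix.mul_assoc Vᵀ, hV, Matrix.one_mul,
          Matrix.trace_mul_comm, ← frobSq_eq_trace]
      linarith
    · rw [Matrix.transpose_mul, Matrix.transpose_transpose, ← Matrix.mul_assoc, Matrix.sub_mul,
        Matrix.mul_assoc (K * V), hV]
      simp
  have hPW : ∀ t, PJ K (Sum.elim t₁ t) * W t = W t := by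
    intro t
    have hs : ∀ j, ∃ j', Sum.elim t₁ t j' = t₁ j := fun j => ⟨Sum.inl j, rfl⟩
    have hs' : ∀ j, ∃ j', Sum.elim t₁ t j' = t j := fun j => ⟨Sum.inr j, rfl⟩
    simp only [W]
    rw [Matrix.mul_add, PJ_mul_Zhat K t₁ t _ hs hs', ← Matrix.mul_assoc, ← Matrix.mul_assoc,
      PJ_mul_PJ K t₁ _ hs]
  have hR12 : ∀ t, frobSq (resK K (Sum.elim t₁ t)) ≤ OPT + D2 t := fun t =>
    ((PJ_proj K _).best K (W t * Vᵀ) (by rw [← Matrix.mul_assoc, hPW])).trans (hWV t)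
  have hKQ : ∀ t, frobSq (K - Q t * K) ≤ OPT + D2 t := fun t =>
    ((hQ t).best K (W t * Vᵀ) (by
      rw [← Matrix.mul_assoc]; congr 1; exact proj_mul_self (W t))).trans (hWV t)
  have hED3 : ∀ t, Ew (p2 t) c₃ (D3 t) ≤ ε / 10 * (OPT + D2 t) := by
    intro t
    have := adaptive_var (c := c₃) hn hc₃ (resK K (Sum.elim t₁ t)) (Q t)
    have h4 : (c₃ : ℝ)⁻¹ * (frobSq (resK K (Sum.elim t₁ t)) * frobSq (Q t)) ≤
        ε / 10 * (OPT + D2 t) := by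
      calc _ ≤ (c₃ : ℝ)⁻¹ * ((OPT + D2 t) * k) := by
            apply mul_le_mul_of_nonneg_left _ (by positivity)
            exact mul_le_mul (hR12 t) (hQk t) (frobSq_nonneg _) (by linarith [hD2n t])
        _ = ((c₃ : ℝ)⁻¹ * k) * (OPT + D2 t) := by ring
        _ ≤ _ := mul_le_mul_of_nonneg_right h3 (by linarith [hD2n t])
    refine le_trans (le_of_eq ?_) (this.trans h4)
    congr 1; ext u
    simp only [D3, W3, resK, Matrix.sub_mul]
    congr 1
    simp only [p2, resK]
    abel
  have hfinal : ∀ t u, frobSq (K - PJ K (Sum.elim t₁ (Sum.elim t u)) * K *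
      PJ K (Sum.elim t₁ (Sum.elim t u))) ≤ OPT + (D2 t + D3 t u) := by
    intro t u
    set s := Sum.elim t₁ (Sum.elim t u) with hs
    set P := PJ K s with hP
    have hPp : IsOProj P := PJ_proj K s
    have hsub : ∀ j, ∃ j', s j' = Sum.elim t₁ t j := by
      rintro (j | j)
      · exact ⟨Sum.inl j, rfl⟩
      · exact ⟨Sum.inr (Sum.inl j), rfl⟩
    have hsub' : ∀ j, ∃ j', s j' = u j := fun j => ⟨Sum.inr (Sum.inr j), rfl⟩
    have hPQ : P * Q t = Q t := by
      have : P * W t = W t := by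
        rw [← hPW t, ← Matrix.mul_assoc, hP, PJ_mul_PJ K _ s hsub]
      simp only [Q]
      rw [← Matrix.mul_assoc, this]
    have hPW3 : P * W3 t u = W3 t u := by
      simp only [W3]
      rw [Matrix.mul_add, hP, PJ_mul_Zhat K _ u s hsub hsub', ← Matrix.mul_assoc (PJ K s),
        ← Matrix.mul_assoc (PJ K s), PJ_mul_PJ K _ s hsub]
    have b1 := hPp.best_two K (Q t * K * P)
      (by rw [← Matrix.mul_assoc, ← Matrix.mul_assoc, hPQ])
      (by rw [Matrix.mul_assoc, hPp.2])
    refine b1.trans ?_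
    have e : K - Q t * K * P = (K - Q t * K) + Q t * (K - K * P) := by
      rw [Matrix.mul_sub, ← Matrix.mul_assoc]; abel
    rw [e, frobSq_add_of_left]
    · have b2 : frobSq (Q t * (K - K * P)) ≤ D3 t u := by
        rw [← frobSq_transpose]
        have : (Q t * (K - K * P))ᵀ = K * Q t - P * (K * Q t) := by
          rw [Matrix.transpose_mul, Matrix.transpose_sub, Matrix.transpose_mul, hK, hPp.1,
            (hQ t).1, Matrix.sub_mul, Matrix.mul_assoc]
        rw [this]
        exact hPp.best _ _ hPW3
      linarith [hKQ t]
    · exact (hQ t).orth K (K - K * P)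
  -- Markov
  let q : (Fin c₂ → Fin n) × (Fin c₃ → Fin n) → ℝ := fun w =>
    (∏ j, p (w.1 j)) * ∏ j, p2 w.1 (w.2 j)
  have hEq : ∀ f : (Fin c₂ → Fin n) → (Fin c₃ → Fin n) → ℝ,
      ∑ w : (Fin c₂ → Fin n) × (Fin c₃ → Fin n), q w * f w.1 w.2 =
      Ew p c₂ (fun t => Ew (p2 t) c₃ (f t)) := by
    intro f
    rw [Fintype.sum_prod_type]
    simp only [Ew, q, Finset.mul_sum]
    exact Finset.sum_congr rfl fun t _ => Finset.sum_congr rfl fun u _ => by ring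
  have hq0 : ∀ w, 0 ≤ q w := fun w =>
    mul_nonneg (Finset.prod_nonneg fun _ _ => hp0 _) (Finset.prod_nonneg fun _ _ => hp20 _ _)
  have hq1 : ∑ w, q w = 1 := by
    have := hEq (fun _ _ => 1)
    simp only [mul_one] at this
    rw [this]
    simp only [Ew_const (hp21 _), Ew_const hp1]
  have hEtot : ∑ w, q w * (D2 w.1 + D3 w.1 w.2) ≤ a * ((2 * ε + ε ^ 2) * OPT) := by
    rw [hEq (fun t u => D2 t + D3 t u)]
    refine le_trans ?_ ha
    have hr0 : 0 ≤ r := frobSq_nonneg _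
    calc Ew p c₂ (fun t => Ew (p2 t) c₃ (fun u => D2 t + D3 t u))
        ≤ Ew p c₂ (fun t => (1 + ε / 10) * D2 t + ε / 10 * OPT) := by
          refine Ew_mono hp0 fun t => ?_
          rw [Ew_add, Ew_const (hp21 t)]
          linarith [hED3 t]
      _ = (1 + ε / 10) * Ew p c₂ D2 + ε / 10 * OPT := by
          rw [Ew_add, Ew_const hp1, Ew_mul]
      _ ≤ (1 + ε / 10) * (ε / 17.5 * r) + ε / 10 * OPT := by
          have : Ew p c₂ D2 ≤ ε / 17.5 * r := by
            refine hED2.trans ?_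
            calc (c₂ : ℝ)⁻¹ * (r * k) = ((c₂ : ℝ)⁻¹ * k) * r := by ring
              _ ≤ _ := mul_le_mul_of_nonneg_right h2 hr0
          have h1 : (0 : ℝ) ≤ 1 + ε / 10 := by positivity
          linarith [mul_le_mul_of_nonneg_left this h1]
      _ ≤ ε * (r * (1.1 / 17.5) + OPT / 10) := by
          have : (1 + ε / 10) * (ε / 17.5 * r) ≤ 1.1 * (ε / 17.5 * r) :=
            mul_le_mul_of_nonneg_right (by linarith) (by positivity)
          have e : 1.1 * (ε / 17.5 * r) + ε / 10 * OPT =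
            ε * (r * (1.1 / 17.5) + OPT / 10) := by ring
          linarith
  have hm := markov_fin q (fun w => D2 w.1 + D3 w.1 w.2) hq0 hq1
    (fun w => add_nonneg (hD2n _) (hD3n _ _)) a _ (by positivity) hEtot ha0
  refine hm.trans (Finset.sum_le_sum fun w _ => ?_)
  split_ifs with i1 i2 i2
  · exact le_rfl
  · exact absurd ((hfinal w.1 w.2).trans (by nlinarith)) i2
  · exact hq0 w
  · exact le_rfl

end PartD


/-- Randomized Kaczmarz error matrix. -/
noncomputable def EE {n k : ℕ} (V : Matrix (Fin n) (Fin k) ℝ) (γ : ℝ) :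
    (c : ℕ) → (Fin c → Fin n) → Matrix (Fin k) (Fin k) ℝ
  | 0, _ => 1
  | c + 1, t => EE V γ c (Fin.tail t) -
      γ • vecMulVec (V (t 0)) (V (t 0) ᵥ* EE V γ c (Fin.tail t))

/-- Randomized Kaczmarz iterate, supported on the sampled rows. -/
noncomputable def WW {n k : ℕ} (V : Matrix (Fin n) (Fin k) ℝ) (γ : ℝ) :
    (c : ℕ) → (Fin c → Fin n) → Matrix (Fin n) (Fin k) ℝ
  | 0, _ => 0
  | c + 1, t => WW V γ c (Fin.tail t) +
      γ • vecMulVec (Pi.single (t 0) 1) (V (t 0) ᵥ* EE V γ c (Fin.tail t))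

section PartE
variable {n k : ℕ} (V : Matrix (Fin n) (Fin k) ℝ) (γ : ℝ)

theorem vecMul_EE_succ (c : ℕ) (x : Fin k → ℝ) (i : Fin n) (t : Fin c → Fin n) :
    x ᵥ* EE V γ (c + 1) (Fin.cons i t) = (x - (γ * (x ⬝ᵥ V i)) • V i) ᵥ* EE V γ c t := by
  simp only [EE, Fin.tail_cons, Fin.cons_zero]
  rw [Matrix.vecMul_sub, Matrix.vecMul_smul, Matrix.vecMul_vecMulVec, Matrix.sub_vecMul,
    Matrix.smul_vecMul, smul_smul]

theorem sum_dot_sq (hV : Vᵀ * V = 1) (x : Fin k → ℝ) : ∑ i, (x ⬝ᵥ V i) ^ 2 = x ⬝ᵥ x := by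
  have h : (V *ᵥ x) ⬝ᵥ (V *ᵥ x) = x ⬝ᵥ x := by
    rw [Matrix.dotProduct_mulVec, ← Matrix.mulVec_transpose, Matrix.mulVec_mulVec, hV,
      Matrix.one_mulVec]
  rw [← h, dotProduct]
  refine Finset.sum_congr rfl fun i _ => ?_
  rw [sq, Matrix.mulVec, dotProduct_comm]

theorem EE_contract (hn : 0 < n) (hV : Vᵀ * V = 1) (τ : ℝ) (hγ : 0 ≤ γ)
    (hτ : ∀ i, V i ⬝ᵥ V i ≤ τ) (hγτ : γ * τ ≤ 1) (hr : γ / n ≤ 1) (c : ℕ) (x : Fin k → ℝ) :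
    Ew (fun _ : Fin n => (n : ℝ)⁻¹) c
      (fun t => (x ᵥ* EE V γ c t) ⬝ᵥ (x ᵥ* EE V γ c t)) ≤ (1 - γ / n) ^ c * (x ⬝ᵥ x) := by
  induction c generalizing x with
  | zero => rw [Ew_zero]; simp [EE]
  | succ c ih =>
    rw [Ew_succ]
    simp only [vecMul_EE_succ]
    have hn' : (0 : ℝ) < n := by exact_mod_cast hn
    have hpow : 0 ≤ (1 - γ / n) ^ c := pow_nonneg (by linarith) _
    have h1 : ∀ i, (x - (γ * (x ⬝ᵥ V i)) • V i) ⬝ᵥ (x - (γ * (x ⬝ᵥ V i)) • V i) ≤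
        x ⬝ᵥ x - γ * (x ⬝ᵥ V i) ^ 2 := by
      intro i
      have e : (x - (γ * (x ⬝ᵥ V i)) • V i) ⬝ᵥ (x - (γ * (x ⬝ᵥ V i)) • V i) =
          x ⬝ᵥ x - 2 * γ * (x ⬝ᵥ V i) ^ 2 + γ * (γ * (V i ⬝ᵥ V i)) * (x ⬝ᵥ V i) ^ 2 := by
        simp only [sub_dotProduct, dotProduct_sub, smul_dotProduct, dotProduct_smul, smul_eq_mul,
          dotProduct_comm (V i) x]
        ring
      have h2 : γ * (V i ⬝ᵥ V i) ≤ 1 :=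
        (mul_le_mul_of_nonneg_left (hτ i) hγ).trans hγτ
      have h3 := mul_le_mul_of_nonneg_left h2 hγ
      have h4 := mul_le_mul_of_nonneg_right h3 (sq_nonneg (x ⬝ᵥ V i))
      rw [e]; linarith
    calc _ ≤ ∑ i, (n : ℝ)⁻¹ * ((1 - γ / n) ^ c * (x ⬝ᵥ x - γ * (x ⬝ᵥ V i) ^ 2)) := by
          refine Finset.sum_le_sum fun i _ => ?_
          apply mul_le_mul_of_nonneg_left _ (by positivity)
          exact (ih _).trans (mul_le_mul_of_nonneg_left (h1 i) hpow)
      _ = _ := by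
          simp only [← Finset.mul_sum, Finset.sum_sub_distrib]
          rw [sum_dot_sq V hV]
          simp only [Finset.sum_const, Finset.card_univ, Fintype.card_fin, nsmul_eq_mul]
          rw [pow_succ]
          generalize (1 - γ / n) ^ c = q
          field_simp

theorem EE_frob (hn : 0 < n) (hV : Vᵀ * V = 1) (τ : ℝ) (hγ : 0 ≤ γ)
    (hτ : ∀ i, V i ⬝ᵥ V i ≤ τ) (hγτ : γ * τ ≤ 1) (hr : γ / n ≤ 1) (c : ℕ) :
    Ew (fun _ : Fin n => (n : ℝ)⁻¹) c (fun t => frobSq (EE V γ c t)) ≤ k * (1 - γ / n) ^ c := by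
  have h : ∀ t, frobSq (EE V γ c t) =
      ∑ a, ((Pi.single a 1 : Fin k → ℝ) ᵥ* EE V γ c t) ⬝ᵥ ((Pi.single a 1 : Fin k → ℝ) ᵥ* EE V γ c t) := by
    intro t
    refine Finset.sum_congr rfl fun a _ => ?_
    simp [dotProduct, sq, Matrix.row]
  simp only [h]
  rw [Ew_sum]
  refine (Finset.sum_le_sum fun a _ => EE_contract V γ hn hV τ hγ hτ hγτ hr c _).trans ?_
  simp

theorem frobSq_vecMulVec {m d : Type*} [Fintype m] [Fintype d] (a : m → ℝ) (b : d → ℝ) :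
    frobSq (vecMulVec a b) = (a ⬝ᵥ a) * (b ⬝ᵥ b) := by
  simp only [frobSq, vecMulVec_apply, dotProduct]
  rw [Finset.sum_mul_sum]
  exact Finset.sum_congr rfl fun _ _ => Finset.sum_congr rfl fun _ _ => by ring

theorem mul_WW_succ (A : Matrix (Fin n) (Fin n) ℝ) (c : ℕ) (i : Fin n) (t : Fin c → Fin n) :
    A * WW V γ (c + 1) (Fin.cons i t) =
      A * WW V γ c t + γ • vecMulVec (Aᵀ i) (V i ᵥ* EE V γ c t) := by
  simp only [WW, Fin.tail_cons, Fin.cons_zero]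
  rw [Matrix.mul_add, Matrix.mul_smul, Matrix.mul_vecMulVec, Matrix.mulVec_single_one]
  rfl

theorem noise (hn : 0 < n) (hV : Vᵀ * V = 1) (τ : ℝ) (hγ : 0 ≤ γ)
    (hτ : ∀ i, V i ⬝ᵥ V i ≤ τ) (hγτ : γ * τ = 1) (hr : γ / n ≤ 1)
    (A : Matrix (Fin n) (Fin n) ℝ) (hA : A * V = 0) (c : ℕ) :
    Ew (fun _ : Fin n => (n : ℝ)⁻¹) c (fun t => frobSq (A * WW V γ c t)) ≤
      frobSq A * (1 - (1 - γ / n) ^ c) := by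
  have hn' : (0 : ℝ) < n := by exact_mod_cast hn
  induction c with
  | zero => rw [Ew_zero]; simp [WW, frobSq_zero]
  | succ c ih =>
    set u : Fin n → ℝ := fun _ : Fin n => (n : ℝ)⁻¹ with hu
    have hu0 : ∀ i, 0 ≤ u i := fun i => by simp only [hu]; positivity
    have hu1 : ∑ i, u i = 1 := by simp [hu]; field_simp
    rw [Ew_succ]
    have hstep : ∀ t : Fin c → Fin n,
        ∑ i, u i * frobSq (A * WW V γ (c + 1) (Fin.cons i t)) = frobSq (A * WW V γ c t) +
          ∑ i, u i * (γ ^ 2 * ((Aᵀ i ⬝ᵥ Aᵀ i) *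
            ((V i ᵥ* EE V γ c t) ⬝ᵥ (V i ᵥ* EE V γ c t)))) := by
      intro t
      have e1 : ∀ i, frobSq (A * WW V γ (c + 1) (Fin.cons i t)) = frobSq (A * WW V γ c t) +
          2 * γ * ((A * WW V γ c t)ᵀ * vecMulVec (Aᵀ i) (V i ᵥ* EE V γ c t)).trace +
          γ ^ 2 * ((Aᵀ i ⬝ᵥ Aᵀ i) * ((V i ᵥ* EE V γ c t) ⬝ᵥ (V i ᵥ* EE V γ c t))) := by
        intro i
        rw [mul_WW_succ, frobSq_add, Matrix.mul_smul, Matrix.trace_smul, ← frobSq_vecMulVec]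
        have : frobSq (γ • vecMulVec (Aᵀ i) (V i ᵥ* EE V γ c t)) =
            γ ^ 2 * frobSq (vecMulVec (Aᵀ i) (V i ᵥ* EE V γ c t)) := by
          simp only [frobSq, Matrix.smul_apply, smul_eq_mul, mul_pow, Finset.mul_sum]
        rw [this, smul_eq_mul]; ring
      have e2 : ∑ i, vecMulVec (Aᵀ i) (V i ᵥ* EE V γ c t) = 0 := by
        have : ∑ i, vecMulVec (Aᵀ i) (V i ᵥ* EE V γ c t) = A * (V * EE V γ c t) := by
          ext a b
          rw [Matrix.sum_apply, Matrix.mul_apply]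
          refine Finset.sum_congr rfl fun i _ => ?_
          rw [vecMulVec_apply]; rfl
        rw [this, ← Matrix.mul_assoc, hA, Matrix.zero_mul]
      have e3 : ∑ i, ((A * WW V γ c t)ᵀ * vecMulVec (Aᵀ i) (V i ᵥ* EE V γ c t)).trace = 0 := by
        rw [← Matrix.trace_sum, ← Matrix.mul_sum, e2]; simp
      simp only [e1, mul_add, Finset.sum_add_distrib]
      congr 1
      rw [← Finset.sum_mul, hu1, one_mul]
      simp only [hu]
      rw [← Finset.mul_sum, ← Finset.mul_sum, e3]; simp
    have hswap : ∑ i, u i * Ew u c (fun t => frobSq (A * WW V γ (c + 1) (Fin.cons i t))) =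
        Ew u c (fun t => frobSq (A * WW V γ c t)) + ∑ i, u i * (γ ^ 2 * ((Aᵀ i ⬝ᵥ Aᵀ i) *
          Ew u c (fun t => (V i ᵥ* EE V γ c t) ⬝ᵥ (V i ᵥ* EE V γ c t)))) := by
      simp only [← Ew_mul]
      rw [← Ew_sum, ← Ew_sum, ← Ew_add]
      simp only [hstep]
    rw [hswap]
    have hpow : 0 ≤ (1 - γ / n) ^ c := pow_nonneg (by linarith) _
    have hnn : ∀ i, 0 ≤ Aᵀ i ⬝ᵥ Aᵀ i := fun i => by
      rw [dotProduct]; exact Finset.sum_nonneg fun _ _ => mul_self_nonneg _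
    have h2 : ∑ i, u i * (γ ^ 2 * ((Aᵀ i ⬝ᵥ Aᵀ i) *
          Ew u c (fun t => (V i ᵥ* EE V γ c t) ⬝ᵥ (V i ᵥ* EE V γ c t)))) ≤
          ∑ i, (γ / n * (1 - γ / n) ^ c) * (Aᵀ i ⬝ᵥ Aᵀ i) := by
      refine Finset.sum_le_sum fun i _ => ?_
      have h3 := EE_contract V γ hn hV τ hγ hτ hγτ.le hr c (V i)
      have h4 : Ew u c (fun t => (V i ᵥ* EE V γ c t) ⬝ᵥ (V i ᵥ* EE V γ c t)) ≤
          (1 - γ / n) ^ c * τ := h3.trans (mul_le_mul_of_nonneg_left (hτ i) hpow)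
      calc _ ≤ u i * (γ ^ 2 * ((Aᵀ i ⬝ᵥ Aᵀ i) * ((1 - γ / n) ^ c * τ))) :=
            mul_le_mul_of_nonneg_left (mul_le_mul_of_nonneg_left
              (mul_le_mul_of_nonneg_left h4 (hnn i)) (sq_nonneg _)) (hu0 i)
        _ = (γ * τ) * ((γ / n * (1 - γ / n) ^ c) * (Aᵀ i ⬝ᵥ Aᵀ i)) := by
            simp only [hu]; ring
        _ = _ := by rw [hγτ, one_mul]
    have h5 : ∑ i, (Aᵀ i ⬝ᵥ Aᵀ i) = frobSq A := by
      rw [← frobSq_transpose]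
      simp only [frobSq, dotProduct, sq]
    have h6 : ∑ i, (γ / n * (1 - γ / n) ^ c) * (Aᵀ i ⬝ᵥ Aᵀ i) =
        γ / n * (1 - γ / n) ^ c * frobSq A := by rw [← Finset.mul_sum, h5]
    rw [h6] at h2
    calc _ ≤ frobSq A * (1 - (1 - γ / n) ^ c) + γ / n * (1 - γ / n) ^ c * frobSq A := add_le_add ih h2
      _ = _ := by ring

theorem Vt_WW (c : ℕ) (t : Fin c → Fin n) : Vᵀ * WW V γ c t = 1 - EE V γ c t := by
  induction c with
  | zero => simp [WW, EE]
  | succ c ih =>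
    simp only [WW, EE]
    rw [Matrix.mul_add, ih, Matrix.mul_smul, Matrix.mul_vecMulVec, Matrix.mulVec_single_one]
    have : Vᵀ.col (t 0) = V (t 0) := rfl
    rw [this]; abel

theorem PJ_WW (K P : Matrix (Fin n) (Fin n) ℝ) (c : ℕ) (t : Fin c → Fin n)
    (h : ∀ j a, (P * K) a (t j) = K a (t j)) : P * (K * WW V γ c t) = K * WW V γ c t := by
  induction c with
  | zero => simp [WW]
  | succ c ih =>
    have ht : t = Fin.cons (t 0) (Fin.tail t) := (Fin.cons_self_tail t).symm
    rw [ht, mul_WW_succ, Matrix.mul_add, ih (Fin.tail t) (fun j a => h j.succ a), Matrix.mul_smul,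
      Matrix.mul_vecMulVec]
    congr 3
    ext a
    have := h 0 a
    rw [Matrix.mul_apply] at this
    exact this

theorem stage1_good (K : Matrix (Fin n) (Fin n) ℝ) (hV : Vᵀ * V = 1) (c : ℕ) (t : Fin c → Fin n)
    (hE : frobSq (EE V γ c t) ≤ 1 / 4) :
    frobSq (resK K t) ≤ frobSq (K - K * V * Vᵀ) +
      4 * frobSq ((K - K * V * Vᵀ) * WW V γ c t) := by
  set E := EE V γ c t with hEd
  set W := WW V γ c t with hW
  set A := K - K * V * Vᵀ with hA
  have hAV : A * V = 0 := by
    rw [hA, Matrix.sub_mul, Matrix.mul_assoc (K * V), hV]; simp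
  have hunit : IsUnit (1 - E) := by
    rw [← Matrix.mulVec_injective_iff_isUnit]
    intro x y hxy
    have h0 : (1 - E) *ᵥ (x - y) = 0 := by
      rw [Matrix.mulVec_sub]; exact sub_eq_zero.2 hxy
    set z := x - y with hz
    have h1 : z = E *ᵥ z := by
      rw [Matrix.sub_mulVec, Matrix.one_mulVec] at h0
      exact sub_eq_zero.1 h0
    have h2 : replicateCol Unit z = E * replicateCol Unit z := by
      rw [← Matrix.replicateCol_mulVec, ← h1]
    have h3 := frobSq_mul_le E (replicateCol Unit z)
    rw [← h2] at h3
    have h4 := frobSq_nonneg (replicateCol Unit z)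
    have h5 : frobSq (replicateCol Unit z) = 0 := by nlinarith
    have h6 := frobSq_eq_zero h5
    have h7 : z = 0 := by
      ext i; exact congrFun (congrFun h6 i) ()
    exact sub_eq_zero.1 h7
  obtain ⟨H, hH⟩ := hunit.exists_right_inv
  have hVW : Vᵀ * (W * H) = 1 := by
    rw [← Matrix.mul_assoc, Vt_WW, hH]
  set M := A * (W * H) with hM
  have hM2 : M = A * W + M * E := by
    have hH' : H * (1 - E) = 1 := mul_eq_one_comm.1 hH
    have : M * (1 - E) = A * W := by
      rw [hM, Matrix.mul_assoc, Matrix.mul_assoc, hH', Matrix.mul_one]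
    rw [← this, Matrix.mul_sub, Matrix.mul_one]; abel
  have hMle : frobSq M ≤ 4 * frobSq (A * W) := by
    have h1 := frobSq_add_le (A * W) (M * E)
    rw [← hM2] at h1
    have h2 := frobSq_mul_le M E
    have h3 := mul_le_mul_of_nonneg_left hE (frobSq_nonneg M)
    linarith
  have hPY : PJ K t * (K * (W * H) * Vᵀ) = K * (W * H) * Vᵀ := by
    have := PJ_WW V γ K (PJ K t) c t (fun j a => PJ_col K t a j)
    rw [← hW] at this
    rw [← Matrix.mul_assoc K, ← Matrix.mul_assoc, ← Matrix.mul_assoc, this]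
  have hbest := (PJ_proj K t).best K _ hPY
  have e : K - K * (W * H) * Vᵀ = A + (-(M * Vᵀ)) := by
    have : M = K * (W * H) - K * V := by
      rw [hM, hA, Matrix.sub_mul, Matrix.mul_assoc (K * V), hVW, Matrix.mul_one]
    rw [this, hA, Matrix.sub_mul]; abel
  rw [e, frobSq_add_of_right] at hbest
  · have h1 : frobSq (-(M * Vᵀ)) = frobSq M := by
      have : frobSq (-(M * Vᵀ)) = frobSq (M * Vᵀ) := by simp [frobSq]
      rw [this, ← frobSq_transpose, frobSq_eq_trace, Matrix.transpose_transpose,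
        Matrix.transpose_mul, Matrix.transpose_transpose, Matrix.mul_assoc,
        ← Matrix.mul_assoc Vᵀ, hV, Matrix.one_mul, Matrix.trace_mul_comm, ← frobSq_eq_trace]
    rw [h1] at hbest
    exact hbest.trans (by linarith)
  · rw [Matrix.transpose_neg, Matrix.transpose_mul, Matrix.transpose_transpose, Matrix.mul_neg,
      ← Matrix.mul_assoc, hAV]
    simp

end PartE


theorem coupling {n c : ℕ} (hn : 0 < n) (hc : c ≤ n) (g : (Fin c → Fin n) → ℝ)
    (hg : ∀ s s' : Fin c → Fin n, (∀ j, ∃ j', s' j' = s j) → g s' ≤ g s) :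
    ∑ t : Fin c → Fin n, (if Function.Injective t then ((Fintype.card (Fin c ↪ Fin n) : ℝ))⁻¹
      else 0) * g t ≤ Ew (fun _ => (n : ℝ)⁻¹) c g := by
  have e0 : ∑ t : Fin c → Fin n, (if Function.Injective t then
      ((Fintype.card (Fin c ↪ Fin n) : ℝ))⁻¹ else 0) * g t =
      (Fintype.card (Fin c ↪ Fin n) : ℝ)⁻¹ * ∑ e : Fin c ↪ Fin n, g e := by
    rw [← (Equiv.subtypeInjectiveEquivEmbedding (Fin c) (Fin n)).sum_comp, Finset.mul_sum]
    simp only [ite_mul, zero_mul]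
    rw [← Finset.sum_filter, ← Finset.sum_subtype_eq_sum_filter, ← Finset.subtype_univ]
    rfl
  rw [e0]
  set F : (Fin c → Fin n) → ℝ := fun t => ∑ σ : Equiv.Perm (Fin n), g (σ ∘ t) with hF
  have hne : Nonempty (Fin c ↪ Fin n) := ⟨Fin.castLEEmb hc⟩
  obtain ⟨e₁⟩ := hne
  have hconst : ∀ e : Fin c ↪ Fin n, F e = F e₁ := by
    intro e
    obtain ⟨τ, hτ⟩ := Equiv.Perm.exists_extending_pair e₁ e e₁.injective e.injective
    have : (e : Fin c → Fin n) = τ ∘ e₁ := by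
      ext j; simp [hτ]
    simp only [hF, this]
    rw [← Equiv.sum_comp (Equiv.mulRight τ) (fun σ : Equiv.Perm (Fin n) => g (σ ∘ e₁))]
    rfl
  have hN : (0 : ℝ) < Fintype.card (Fin c ↪ Fin n) := by
    have : 0 < Fintype.card (Fin c ↪ Fin n) := Fintype.card_pos_iff.2 ⟨e₁⟩
    exact_mod_cast this
  set M : ℝ := ((Fintype.card (Equiv.Perm (Fin n)) : ℕ) : ℝ) with hM
  have hM0 : 0 < M := by
    have : 0 < Fintype.card (Equiv.Perm (Fin n)) := Fintype.card_pos
    rw [hM]; exact_mod_cast this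
  have h1 : (Fintype.card (Fin c ↪ Fin n) : ℝ) * F e₁ = M * ∑ e : Fin c ↪ Fin n, g e := by
    have : ∑ e : Fin c ↪ Fin n, F e = (Fintype.card (Fin c ↪ Fin n) : ℝ) * F e₁ := by
      simp [hconst]
    rw [← this]
    simp only [hF]
    rw [Finset.sum_comm]
    have h2 : ∀ σ : Equiv.Perm (Fin n), ∑ e : Fin c ↪ Fin n, g (σ ∘ e) =
        ∑ e : Fin c ↪ Fin n, g e := by
      intro σ
      rw [← (Equiv.embeddingCongr (Equiv.refl (Fin c)) σ).sum_comp
        (fun e : Fin c ↪ Fin n => g e)]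
      rfl
    simp [h2, hM]
  have h3 : ((n : ℝ) ^ c) * F e₁ ≤ M * ∑ t, g t := by
    have h4 : ∑ t, F t = M * ∑ t, g t := by
      simp only [hF]
      rw [Finset.sum_comm]
      have h2 : ∀ σ : Equiv.Perm (Fin n), ∑ t : Fin c → Fin n, g (σ ∘ t) = ∑ t, g t := by
        intro σ
        rw [← (Equiv.arrowCongr (Equiv.refl (Fin c)) σ).sum_comp g]
        rfl
      simp [h2, hM]
    rw [← h4]
    have h5 : ∀ t, F e₁ ≤ F t := by
      intro t
      obtain ⟨T, hT1, hT2⟩ : ∃ T : Finset (Fin n), Finset.univ.image t ⊆ T ∧ T.card = c := by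
        apply Finset.exists_superset_card_eq
        · exact Finset.card_image_le.trans (by simp)
        · simpa using hc
      let e : Fin c ↪ Fin n := (T.orderEmbOfFin hT2).toEmbedding
      rw [← hconst e]
      refine Finset.sum_le_sum fun σ _ => hg _ _ fun j => ?_
      have hj : t j ∈ T := hT1 (Finset.mem_image_of_mem _ (Finset.mem_univ _))
      have : t j ∈ Set.range (T.orderEmbOfFin hT2) := by
        rw [Finset.range_orderEmbOfFin]; exact hj
      obtain ⟨j', hj'⟩ := this
      exact ⟨j', congrArg σ hj'⟩
    calc (n : ℝ) ^ c * F e₁ = ∑ _t : Fin c → Fin n, F e₁ := by simp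
      _ ≤ _ := Finset.sum_le_sum fun t _ => h5 t
  have hn' : (0 : ℝ) < n := by exact_mod_cast hn
  have e2 : Ew (fun _ => (n : ℝ)⁻¹) c g = ((n : ℝ) ^ c)⁻¹ * ∑ t, g t := by
    simp [Ew, Finset.mul_sum]
  rw [e2]
  have hnc : 0 < (n : ℝ) ^ c := pow_pos hn' c
  have h6 : (Fintype.card (Fin c ↪ Fin n) : ℝ)⁻¹ * ∑ e : Fin c ↪ Fin n, g e = F e₁ / M := by
    rw [inv_mul_eq_div, div_eq_div_iff hN.ne' hM0.ne']; linarith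
  rw [h6, inv_mul_eq_div, div_le_div_iff₀ hM0 hnc]
  linarith

/-- Failure bound as a function of the first residual. -/
noncomputable def failB (OPT r : ℝ) : ℝ :=
  if OPT = 0 then (if r ≤ 0 then 0 else 1) else min 1 (r / (25 * OPT) + 1 / 20)

theorem failB_le_one (OPT r : ℝ) : failB OPT r ≤ 1 := by
  unfold failB
  split_ifs <;> simp

theorem failB_nonneg (OPT r : ℝ) (hO : 0 ≤ OPT) (hr : 0 ≤ r) : 0 ≤ failB OPT r := by
  unfold failB
  split_ifs
  · simp
  · simp
  · exact le_min zero_le_one (by positivity)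

theorem failB_mono (OPT : ℝ) (hO : 0 ≤ OPT) {r r' : ℝ} (h : r ≤ r') :
    failB OPT r ≤ failB OPT r' := by
  unfold failB
  split_ifs
  · simp
  · simp
  · linarith
  · simp
  · gcongr

theorem stage1_expect {n k c : ℕ} (hn : 0 < n) (hk : 0 < k) (K : Matrix (Fin n) (Fin n) ℝ)
    (V : Matrix (Fin n) (Fin k) ℝ) (hV : Vᵀ * V = 1) (OPT : ℝ) (hO : 0 ≤ OPT)
    (hVO : frobSq (K - K * V * Vᵀ) ≤ OPT) (τ : ℝ) (hτ : ∀ i, V i ⬝ᵥ V i ≤ τ)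
    (hc : 20 * (n * τ) * Real.log (20 * k) ≤ c) :
    Ew (fun _ : Fin n => (n : ℝ)⁻¹) c (fun t => failB OPT (frobSq (resK K t))) ≤ 3 / 10 := by
  have hn' : (0 : ℝ) < n := by exact_mod_cast hn
  have hk' : (1 : ℝ) ≤ k := by exact_mod_cast hk
  have hnτ : (1 : ℝ) ≤ n * τ := by
    have h1 : ∑ i, V i ⬝ᵥ V i = k := by
      have : frobSq V = k := by rw [frobSq_eq_trace, hV]; simp
      rw [← this]; simp only [frobSq, dotProduct, sq]
    have h2 : ∑ i, V i ⬝ᵥ V i ≤ n * τ := by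
      refine (Finset.sum_le_sum fun i _ => hτ i).trans (by simp)
    linarith
  have hτ0 : 0 < τ := by
    by_contra h
    have := mul_nonpos_of_nonneg_of_nonpos hn'.le (not_lt.1 h)
    linarith
  set γ : ℝ := 1 / τ with hγ
  have hγ0 : 0 ≤ γ := by positivity
  have hγτ : γ * τ = 1 := by rw [hγ]; field_simp
  have hx : γ / n = 1 / (n * τ) := by rw [hγ]; field_simp
  have hr : γ / n ≤ 1 := by rw [hx, div_le_one (by linarith)]; exact hnτ
  set A := K - K * V * Vᵀ with hA
  have hAV : A * V = 0 := by
    rw [hA, Matrix.sub_mul, Matrix.mul_assoc (K * V), hV]; simp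
  have hpow0 : 0 ≤ (1 - γ / n) ^ c := pow_nonneg (by linarith) _
  have hbad : 4 * (k * (1 - γ / n) ^ c) ≤ 1 / 100 := by
    have hL : 0 ≤ Real.log (20 * k) := Real.log_nonneg (by linarith)
    have h1 : (1 - γ / n) ^ c ≤ Real.exp (-(2 * Real.log (20 * k))) := by
      have h2 : 1 - γ / n ≤ Real.exp (-(γ / n)) := by
        have := Real.add_one_le_exp (-(γ / n)); linarith
      refine (pow_le_pow_left₀ (by linarith) h2 c).trans ?_
      rw [← Real.exp_nat_mul]
      apply Real.exp_le_exp.2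
      have h3 : 20 * Real.log (20 * k) ≤ c * (γ / n) := by
        rw [hx, mul_one_div, le_div_iff₀ (by linarith)]; linarith
      linarith
    have h4 : Real.exp (-(2 * Real.log (20 * k))) = 1 / (20 * k) ^ 2 := by
      rw [Real.exp_neg, two_mul, Real.exp_add, Real.exp_log (by linarith)]
      rw [sq, one_div]
    rw [h4] at h1
    have h5 : 4 * ((k : ℝ) * (1 - γ / n) ^ c) ≤ 4 * (k * (1 / (20 * k) ^ 2)) := by gcongr
    refine h5.trans ?_
    have : 4 * ((k : ℝ) * (1 / (20 * k) ^ 2)) = 1 / (100 * k) := by field_simp; norm_num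
    rw [this]
    apply one_div_le_one_div_of_le <;> linarith
  have hp0 : ∀ i : Fin n, 0 ≤ (fun _ : Fin n => (n : ℝ)⁻¹) i := fun _ => by positivity
  have hp1 : ∑ i : Fin n, (fun _ : Fin n => (n : ℝ)⁻¹) i = 1 := by
    simp; field_simp
  set δ : ℝ := 1 / (25 * OPT) with hδ
  have hδ0 : 0 ≤ δ := by positivity
  have hδO : δ * OPT ≤ 1 / 25 := by
    rcases hO.eq_or_lt with h | h
    · rw [← h]; norm_num
    · rw [hδ]; apply le_of_eq; field_simp
  have hpt : ∀ t : Fin c → Fin n, failB OPT (frobSq (resK K t)) ≤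
      4 * frobSq (EE V γ c t) + (4 * δ * frobSq (A * WW V γ c t) + (1 / 20 + δ * OPT)) := by
    intro t
    have hE0 := frobSq_nonneg (EE V γ c t)
    have hN0 := frobSq_nonneg (A * WW V γ c t)
    have hN1 : 0 ≤ 4 * δ * frobSq (A * WW V γ c t) := by positivity
    have hO1 : 0 ≤ δ * OPT := by positivity
    by_cases hE : frobSq (EE V γ c t) ≤ 1 / 4
    · have hg := stage1_good V γ K hV c t hE
      rw [← hA] at hg
      by_cases hO' : OPT = 0
      · have hA0 : A = 0 := frobSq_eq_zero (le_antisymm (by linarith) (frobSq_nonneg _))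
        have : frobSq (resK K t) ≤ 0 := by
          rw [hA0] at hg
          simpa [frobSq_zero] using hg
        have : failB OPT (frobSq (resK K t)) = 0 := by
          unfold failB; rw [if_pos hO', if_pos this]
        linarith
      · have : failB OPT (frobSq (resK K t)) ≤ δ * frobSq (resK K t) + 1 / 20 := by
          unfold failB; rw [if_neg hO']
          refine (min_le_right _ _).trans (le_of_eq ?_)
          rw [hδ]; ring
        have h2 := mul_le_mul_of_nonneg_left hg hδ0
        have h3 := mul_le_mul_of_nonneg_left hVO hδ0
        linarith
    · have := failB_le_one OPT (frobSq (resK K t))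
      linarith
  refine (Ew_mono hp0 hpt).trans ?_
  rw [Ew_add, Ew_add, Ew_mul, Ew_mul, Ew_const hp1]
  have h1 := EE_frob V γ hn hV τ hγ0 hτ hγτ.le hr c
  have h2 := noise V γ hn hV τ hγ0 hτ hγτ hr A hAV c
  have h3 : Ew (fun _ : Fin n => (n : ℝ)⁻¹) c (fun t => frobSq (A * WW V γ c t)) ≤ OPT := by
    refine h2.trans ?_
    have := mul_nonneg (frobSq_nonneg A) hpow0
    linarith
  have h4 := mul_le_mul_of_nonneg_left h3 hδ0
  linarith


/-- The uniform+adaptive² column selection algorithm for the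
prototype model of a symmetric matrix `K` attains a `1+ε` relative-error
bound with probability at least 0.7.  The first stage chooses `c₁` columns
uniformly without replacement (uniform over injective index tuples), the
second and third stages choose `c₂` resp. `c₃` columns i.i.d. with the
adaptive probabilities determined by the current residual.  `Vk` is a top-`k`
right singular vector matrix of `K` and `μ` the corresponding coherence. -/
theorem uniform_adaptive2_prototype {n k c₁ c₂ c₃ : ℕ} (hk : 0 < k) (hkn : k ≤ n)
    (K : Matrix (Fin n) (Fin n) ℝ) (hKsym : K.IsSymm)
    (ε : ℝ) (hε : 0 < ε) (hε1 : ε ≤ 1)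
    (Vk : Matrix (Fin n) (Fin k) ℝ) (hV1 : Vkᵀ * Vk = 1)
    (hV2 : Kᵀ * K * Vk =
      Vk * Matrix.diagonal (fun i : Fin k => (svalsDesc K (Fin.castLE hkn i)) ^ 2))
    (μ : ℝ) (hμ : μ = ((n : ℝ) / k) * ⨆ j : Fin n, ∑ i : Fin k, (Vk j i) ^ 2)
    (hc₁ : (c₁ : ℝ) ≥ 20 * μ * k * Real.log (20 * k)) (hc₁n : c₁ ≤ n)
    (hc₂ : (c₂ : ℝ) ≥ 17.5 * k / ε) (hc₃ : (c₃ : ℝ) ≥ 10 * k / ε)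
    (Kk : Matrix (Fin n) (Fin n) ℝ) (hKk : IsBestRankApprox K Kk k) :
    (7 / 10 : ℝ) ≤
      ∑ ω : (Fin c₁ → Fin n) × (Fin c₂ → Fin n) × (Fin c₃ → Fin n),
        if frobNorm (K -
              K.submatrix id (Sum.elim ω.1 (Sum.elim ω.2.1 ω.2.2)) *
                pinv (K.submatrix id (Sum.elim ω.1 (Sum.elim ω.2.1 ω.2.2))) * K *
                (pinv (K.submatrix id (Sum.elim ω.1 (Sum.elim ω.2.1 ω.2.2))))ᵀ *
                (K.submatrix id (Sum.elim ω.1 (Sum.elim ω.2.1 ω.2.2)))ᵀ) ≤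
            (1 + ε) * frobNorm (K - Kk)
        then
          (if Function.Injective ω.1 then ((Fintype.card (Fin c₁ ↪ Fin n) : ℝ))⁻¹ else 0) *
            (∏ j, adaptP (K - K.submatrix id ω.1 * pinv (K.submatrix id ω.1) * K) (ω.2.1 j)) *
            (∏ j, adaptP (K -
                K.submatrix id (Sum.elim ω.1 ω.2.1) *
                  pinv (K.submatrix id (Sum.elim ω.1 ω.2.1)) * K) (ω.2.2 j))
        else 0 := by
  have hn : 0 < n := lt_of_lt_of_le hk hkn
  have hk' : (0 : ℝ) < k := by exact_mod_cast hk
  have hn' : (0 : ℝ) < n := by exact_mod_cast hn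
  have hK : Kᵀ = K := hKsym
  set OPT := frobSq (K - Kk) with hOPT
  have hO : 0 ≤ OPT := frobSq_nonneg _
  have hVO : frobSq (K - K * Vk * Vkᵀ) ≤ OPT :=
    eckart_young hk hkn K Kk Vk hV1 hV2 hKk.1
  have hc₂' : (0 : ℝ) < c₂ := lt_of_lt_of_le (by positivity) hc₂
  have hc₃' : (0 : ℝ) < c₃ := lt_of_lt_of_le (by positivity) hc₃
  have h2 : (c₂ : ℝ)⁻¹ * k ≤ ε / 17.5 := by
    rw [ge_iff_le, div_le_iff₀ hε] at hc₂
    rw [inv_mul_eq_div, div_le_div_iff₀ hc₂' (by norm_num)]; linarith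
  have h3 : (c₃ : ℝ)⁻¹ * k ≤ ε / 10 := by
    rw [ge_iff_le, div_le_iff₀ hε] at hc₃
    rw [inv_mul_eq_div, div_le_div_iff₀ hc₃' (by norm_num)]; linarith
  set τ : ℝ := ⨆ j : Fin n, ∑ i : Fin k, (Vk j i) ^ 2 with hτd
  have hτ : ∀ i, Vk i ⬝ᵥ Vk i ≤ τ := by
    intro i
    have : Vk i ⬝ᵥ Vk i = ∑ a : Fin k, (Vk i a) ^ 2 := by simp only [dotProduct, sq]
    rw [this]
    exact le_ciSup (f := fun j : Fin n => ∑ a : Fin k, (Vk j a) ^ 2) (Set.finite_range _).bddAbove i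
  have hcc : 20 * (n * τ) * Real.log (20 * k) ≤ c₁ := by
    have : μ * k = n * τ := by rw [hμ]; field_simp
    rw [← this]; linarith
  have hE := stage1_expect hn hk K Vk hV1 OPT hO hVO τ hτ hcc
  have hcp := coupling hn hc₁n (fun t => failB OPT (frobSq (resK K t)))
    (fun s s' h => failB_mono OPT hO (res_antitone K s s' h))
  set w : (Fin c₁ → Fin n) → ℝ := fun t =>
    if Function.Injective t then ((Fintype.card (Fin c₁ ↪ Fin n) : ℝ))⁻¹ else 0 with hw
  have hw0 : ∀ t, 0 ≤ w t := by
    intro t; simp only [hw]; split_ifs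
    · positivity
    · exact le_rfl
  have hw1 : ∑ t, w t = 1 := by
    have hpos : 0 < Fintype.card (Fin c₁ ↪ Fin n) :=
      Fintype.card_pos_iff.2 ⟨Fin.castLEEmb hc₁n⟩
    have hpos' : (0 : ℝ) < Fintype.card (Fin c₁ ↪ Fin n) := by exact_mod_cast hpos
    simp only [hw]
    rw [← Finset.sum_filter, Finset.sum_const, nsmul_eq_mul, ← Fintype.card_subtype,
      Fintype.card_congr (Equiv.subtypeInjectiveEquivEmbedding (Fin c₁) (Fin n))]
    exact mul_inv_cancel₀ hpos'.ne'
  let S : (Fin c₁ → Fin n) → ℝ := fun t₁ =>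
    ∑ w : (Fin c₂ → Fin n) × (Fin c₃ → Fin n),
      if frobSq (K - PJ K (Sum.elim t₁ (Sum.elim w.1 w.2)) * K *
          PJ K (Sum.elim t₁ (Sum.elim w.1 w.2))) ≤ (1 + ε) ^ 2 * OPT
      then (∏ j, adaptP (resK K t₁) (w.1 j)) *
        ∏ j, adaptP (resK K (Sum.elim t₁ w.1)) (w.2 j) else 0
  have hS0 : ∀ t, 0 ≤ S t := by
    intro t
    refine Finset.sum_nonneg fun v _ => ?_
    split_ifs
    · exact mul_nonneg (Finset.prod_nonneg fun _ _ => adaptP_nonneg _ _)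
        (Finset.prod_nonneg fun _ _ => adaptP_nonneg _ _)
    · exact le_rfl
  have hS : ∀ t, 1 - failB OPT (frobSq (resK K t)) ≤ S t := by
    intro t
    have hr0 := frobSq_nonneg (resK K t)
    set r := frobSq (resK K t) with hr
    rcases (failB_le_one OPT r).eq_or_lt with h1 | h1
    · rw [h1]; linarith [hS0 t]
    · refine stage23 K hn (by exact_mod_cast hc₂') (by exact_mod_cast hc₃') hK ε OPT hε hε1 hO Vk
        hV1 hVO h2 h3 t _ (failB_nonneg OPT r hO hr0) ?_
      rw [← hr]
      by_cases hO' : OPT = 0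
      · have : r ≤ 0 := by
          by_contra h
          unfold failB at h1
          rw [if_pos hO', if_neg h] at h1
          exact lt_irrefl _ h1
        have : r = 0 := le_antisymm this hr0
        rw [this, hO']; simp
      · have hOp : 0 < OPT := lt_of_le_of_ne hO (Ne.symm hO')
        have hf : failB OPT r = r / (25 * OPT) + 1 / 20 := by
          unfold failB at h1 ⊢
          rw [if_neg hO'] at h1 ⊢
          rcases min_lt_iff.1 h1 with h | h
          · exact absurd h (lt_irrefl _)
          · exact min_eq_right h.le
        rw [hf]
        have e : (r / (25 * OPT) + 1 / 20) * ((2 * ε + ε ^ 2) * OPT) =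
            (2 * ε + ε ^ 2) * (r / 25 + OPT / 20) := by field_simp
        rw [e]
        have h5 : 0 ≤ ε ^ 2 * (r / 25 + OPT / 20) := by positivity
        have h6 : 0 ≤ ε * r := by positivity
        have h7 : ε * (r * (1.1 / 17.5) + OPT / 10) ≤ 2 * ε * (r / 25 + OPT / 20) := by
          norm_num; nlinarith
        linarith
  have hmain : (7 / 10 : ℝ) ≤ ∑ t, w t * S t := by
    have h5 : ∑ t, w t * (1 - failB OPT (frobSq (resK K t))) ≤ ∑ t, w t * S t :=
      Finset.sum_le_sum fun t _ => mul_le_mul_of_nonneg_left (hS t) (hw0 t)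
    have h6 : ∑ t, w t * (1 - failB OPT (frobSq (resK K t))) =
        1 - ∑ t, w t * failB OPT (frobSq (resK K t)) := by
      simp only [mul_sub, mul_one, Finset.sum_sub_distrib, hw1]
    have h7 : ∑ t, w t * failB OPT (frobSq (resK K t)) ≤ 3 / 10 := hcp.trans hE
    linarith
  refine hmain.trans ?_
  rw [Fintype.sum_prod_type]
  refine Finset.sum_le_sum fun t _ => ?_
  simp only [S]
  rw [Finset.mul_sum]
  refine Finset.sum_le_sum fun v _ => ?_
  have hq0 : 0 ≤ w t * ((∏ j, adaptP (resK K t) (v.1 j)) *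
      ∏ j, adaptP (resK K (Sum.elim t v.1)) (v.2 j)) :=
    mul_nonneg (hw0 t) (mul_nonneg (Finset.prod_nonneg fun _ _ => adaptP_nonneg _ _)
        (Finset.prod_nonneg fun _ _ => adaptP_nonneg _ _))
  by_cases hgood : frobSq (K - PJ K (Sum.elim t (Sum.elim v.1 v.2)) * K *
          PJ K (Sum.elim t (Sum.elim v.1 v.2))) ≤ (1 + ε) ^ 2 * OPT
  · rw [if_pos hgood, if_pos]
    · rw [← mul_assoc]; exact le_rfl
    · have hT : (pinv (K.submatrix id (Sum.elim t (Sum.elim v.1 v.2))))ᵀ *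
          (K.submatrix id (Sum.elim t (Sum.elim v.1 v.2)))ᵀ =
          PJ K (Sum.elim t (Sum.elim v.1 v.2)) := by
        rw [← Matrix.transpose_mul]
        exact (PJ_proj K (Sum.elim t (Sum.elim v.1 v.2))).1
      rw [Matrix.mul_assoc _ (pinv (K.submatrix id (Sum.elim t (Sum.elim v.1 v.2))))ᵀ, hT]
      change Real.sqrt _ ≤ (1 + ε) * Real.sqrt _
      rw [← hOPT]
      refine (Real.sqrt_le_sqrt hgood).trans (le_of_eq ?_)
      rw [Real.sqrt_mul (sq_nonneg _), Real.sqrt_sq (by linarith)]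
  · rw [if_neg hgood, mul_zero]
    rw [← mul_assoc] at hq0
    exact ite_nonneg hq0 le_rfl
end

section
/- Let n, k, c be positive integers with k < n, let η > 0, and let P ∈ R^{n×c} be a fixed matrix such that for every n×n real symmetric matrix A, setting C = A P, one has ‖A − C C† A (C†)^T C^T‖_F² ≤ η ‖A − A_k‖_F². Let K be any n×n real symmetric positive semidefinite matrix, let δ̄ = (1/(n−k))(tr(K) − Σ_{j=1}^k σ_j(K)), let δ̃ ∈ (0, δ̄], set K̄ = K − δ̃ I_n and C̄ = K̄ P (assume rank(C̄) < n), and let K̃^{ss} = C̄ U^{ss} C̄^T + δ^{ss} I_n, where δ^{ss} = (tr(K) − tr(C̄† K C̄))/(n − rank(C̄)) and U^{ss} = C̄† K (C̄†)^T − δ^{ss} (C̄^T C̄)†. Then ‖K − K̃^{ss}‖_F² ≤ η ‖K̄ − K̄_k‖_F² ≤ η ‖K − K_k‖_F². -/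
open Matrix BigOperators
open scoped Classical

namespace SpecShift

lemma spectral {n : ℕ} (M : Matrix (Fin n) (Fin n) ℝ) (hM : M.IsHermitian) :
    (hM.eigenvectorUnitary : Matrix (Fin n) (Fin n) ℝ)ᵀ * hM.eigenvectorUnitary = 1 ∧
    M = (hM.eigenvectorUnitary : Matrix (Fin n) (Fin n) ℝ) * diagonal hM.eigenvalues *
      (hM.eigenvectorUnitary : Matrix (Fin n) (Fin n) ℝ)ᵀ := by
  constructor
  · have := Unitary.coe_star_mul_self hM.eigenvectorUnitary
    rwa [star_eq_conjTranspose, conjTranspose_eq_transpose_of_trivial] at this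
  · have := hM.spectral_theorem
    rw [Unitary.conjStarAlgAut_apply, star_eq_conjTranspose,
      conjTranspose_eq_transpose_of_trivial] at this
    exact this

lemma gram_cancel {m n p : ℕ} (A : Matrix (Fin m) (Fin n) ℝ) (B : Matrix (Fin n) (Fin p) ℝ)
    (h : Aᵀ * A * B = 0) : A * B = 0 := by
  have := (conjTranspose_mul_self_mul_eq_zero A B).1
  rw [conjTranspose_eq_transpose_of_trivial] at this
  exact this h

lemma exists_mp_symm {n : ℕ} (M : Matrix (Fin n) (Fin n) ℝ) (hM : M.IsHermitian) :
    ∃ B, IsMoorePenrose M B := by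
  obtain ⟨h1, h2⟩ := spectral M hM
  set V := (hM.eigenvectorUnitary : Matrix (Fin n) (Fin n) ℝ)
  set d := hM.eigenvalues
  have key : ∀ x y : Fin n → ℝ, (V * diagonal x * Vᵀ) * (V * diagonal y * Vᵀ) =
      V * diagonal (x * y) * Vᵀ := by
    intro x y
    calc _ = V * diagonal x * (Vᵀ * V) * diagonal y * Vᵀ := by simp only [Matrix.mul_assoc]
      _ = _ := by
        rw [h1, Matrix.mul_one, Matrix.mul_assoc V, diagonal_mul_diagonal]; rfl
  have kt : ∀ x : Fin n → ℝ, (V * diagonal x * Vᵀ)ᵀ = V * diagonal x * Vᵀ := by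
    intro x
    simp [Matrix.mul_assoc]
  refine ⟨V * diagonal d⁻¹ * Vᵀ, ?_⟩
  rw [IsMoorePenrose, h2]
  simp only [key, kt, and_true]
  refine ⟨?_, ?_⟩ <;> congr 3 <;> ext i <;> by_cases hd : d i = 0 <;> simp [hd]

lemma exists_mp {m n : ℕ} (A : Matrix (Fin m) (Fin n) ℝ) : ∃ B, IsMoorePenrose A B := by
  obtain ⟨H, h1, h2, h3, h4⟩ := exists_mp_symm (Aᵀ * A) (by
    rw [IsHermitian, conjTranspose_eq_transpose_of_trivial]; simp)
  have e1 : A * (H * (Aᵀ * A)) = A := by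
    have := gram_cancel A (H * (Aᵀ * A) - 1) (by
      rw [Matrix.mul_sub, ← Matrix.mul_assoc, h1, Matrix.mul_one, sub_self])
    rw [Matrix.mul_sub, Matrix.mul_one, sub_eq_zero] at this
    exact this
  have e2 : (Aᵀ * A) * Hᵀ * Aᵀ = Aᵀ := by
    have := congrArg transpose e1
    simpa [Matrix.mul_assoc] using this
  have hs : A * H * Aᵀ = A * Hᵀ * Aᵀ := by
    have a1 : A * H * Aᵀ = A * H * (Aᵀ * A) * Hᵀ * Aᵀ := by
      conv_lhs => rw [← e2]
      simp only [Matrix.mul_assoc]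
    have a2 : A * H * (Aᵀ * A) * Hᵀ * Aᵀ = A * Hᵀ * Aᵀ := by
      rw [Matrix.mul_assoc A H, e1]
    rw [a1, a2]
  refine ⟨H * Aᵀ, ?_, ?_, ?_, ?_⟩
  · simpa [Matrix.mul_assoc] using e1
  · calc _ = (H * (Aᵀ * A) * H) * Aᵀ := by simp only [Matrix.mul_assoc]
      _ = _ := by rw [h2]
  · rw [← Matrix.mul_assoc]
    rw [transpose_mul, transpose_mul, transpose_transpose, ← Matrix.mul_assoc, hs]
  · rw [Matrix.mul_assoc]; exact h4

lemma pinv_spec {m n : ℕ} (A : Matrix (Fin m) (Fin n) ℝ) : IsMoorePenrose A (pinv A) := by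
  have h := exists_mp A
  rw [pinv, dif_pos h]
  exact h.choose_spec

lemma gram_proj {m n : ℕ} (C : Matrix (Fin m) (Fin n) ℝ) :
    C * pinv (Cᵀ * C) * Cᵀ = C * pinv C := by
  obtain ⟨g1, -, -, -⟩ := pinv_spec (Cᵀ * C)
  obtain ⟨c1, -, c3, -⟩ := pinv_spec C
  set H := pinv (Cᵀ * C)
  have e1 : C * (H * (Cᵀ * C)) = C := by
    have := gram_cancel C (H * (Cᵀ * C) - 1) (by
      rw [Matrix.mul_sub, ← Matrix.mul_assoc, g1, Matrix.mul_one, sub_self])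
    rw [Matrix.mul_sub, Matrix.mul_one, sub_eq_zero] at this
    exact this
  have e2 : Cᵀ * (C * pinv C) = Cᵀ := by
    rw [← c3, ← transpose_mul, c1]
  calc C * H * Cᵀ = C * H * (Cᵀ * (C * pinv C)) := by rw [e2]
    _ = (C * (H * (Cᵀ * C))) * pinv C := by simp only [Matrix.mul_assoc]
    _ = _ := by rw [e1]

lemma trace_proj {n c : ℕ} (C : Matrix (Fin n) (Fin c) ℝ) :
    (C * pinv C).trace = C.rank := by
  obtain ⟨c1, -, c3, -⟩ := pinv_spec C
  have hp : LinearMap.IsProj (LinearMap.range C.mulVecLin) (Matrix.toLin' (C * pinv C)) := by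
    constructor
    · intro x
      refine ⟨pinv C *ᵥ x, ?_⟩
      simp
    · rintro _ ⟨y, rfl⟩
      simp only [mulVecLin_apply, toLin'_apply, mulVec_mulVec, c1]
  have := hp.trace
  rw [Matrix.trace_toLin'_eq] at this
  rw [this]; rfl

lemma frobSq_eq {m n : ℕ} (A : Matrix (Fin m) (Fin n) ℝ) : frobSq A = (Aᵀ * A).trace := by
  rw [frobSq, Finset.sum_comm]
  simp [Matrix.trace, Matrix.mul_apply, sq]

lemma frobSq_nonneg {m n : ℕ} (A : Matrix (Fin m) (Fin n) ℝ) : 0 ≤ frobSq A :=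
  Finset.sum_nonneg fun _ _ => Finset.sum_nonneg fun _ _ => sq_nonneg _

lemma frobSq_proj {n : ℕ} (R M : Matrix (Fin n) (Fin n) ℝ) (hs : Rᵀ = R) (hi : R * R = R) :
    frobSq (R * M) = (R * (M * Mᵀ)).trace := by
  rw [frobSq_eq, transpose_mul, hs, Matrix.mul_assoc, ← Matrix.mul_assoc R R, hi,
    Matrix.trace_mul_comm, Matrix.mul_assoc]

lemma compl_proj {n : ℕ} (R : Matrix (Fin n) (Fin n) ℝ) (hs : Rᵀ = R) (hi : R * R = R) :
    (1 - R)ᵀ = 1 - R ∧ (1 - R) * (1 - R) = 1 - R := by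
  refine ⟨by simp [hs], ?_⟩
  simp [Matrix.mul_sub, Matrix.sub_mul, hi]

lemma frobSq_proj_le {n : ℕ} (R M : Matrix (Fin n) (Fin n) ℝ) (hs : Rᵀ = R) (hi : R * R = R) :
    frobSq (R * M) ≤ frobSq M := by
  obtain ⟨h1, h2⟩ := compl_proj R hs hi
  have a := frobSq_nonneg ((1 - R) * M)
  rw [frobSq_proj _ _ h1 h2, Matrix.sub_mul, trace_sub] at a
  rw [frobSq_proj _ _ hs hi, frobSq_eq M, Matrix.trace_mul_comm Mᵀ]
  simp at a
  exact a

lemma psd_sqrt_unique {n : ℕ} (K S : Matrix (Fin n) (Fin n) ℝ) (hK : K.PosSemidef)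
    (hS : S.PosSemidef) (h : K * K = S * S) : K = S := by
  open scoped MatrixOrder Matrix.Norms.L2Operator in
  exact (CFC.sq_eq_sq_iff K S hK.nonneg hS.nonneg).1 (by rw [sq, sq, h])

lemma svd_psd {n : ℕ} (K : Matrix (Fin n) (Fin n) ℝ) (hK : K.PosSemidef) :
    Antitone (svalsDesc K) ∧ ∃ V : Matrix (Fin n) (Fin n) ℝ, Vᵀ * V = 1 ∧
      K = V * diagonal (svalsDesc K) * Vᵀ := by
  have hG : (Kᵀ * K).IsHermitian := by
    rw [IsHermitian, conjTranspose_eq_transpose_of_trivial]; simp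
  have hKs : Kᵀ = K := by
    have := hK.1
    rwa [IsHermitian, conjTranspose_eq_transpose_of_trivial] at this
  have hpsd : (Kᵀ * K).PosSemidef := by
    have := posSemidef_conjTranspose_mul_self K
    rwa [conjTranspose_eq_transpose_of_trivial] at this
  obtain ⟨h1, h2⟩ := spectral _ hG
  set U := (hG.eigenvectorUnitary : Matrix (Fin n) (Fin n) ℝ)
  set e := Tuple.sort (fun j => -hG.eigenvalues j) with he
  have hs : svalsDesc K = fun i => Real.sqrt (hG.eigenvalues (e i)) := by
    funext i
    rw [svalsDesc, eigsDesc, dif_pos hG]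
  constructor
  · intro i j hij
    rw [hs]
    apply Real.sqrt_le_sqrt
    have := Tuple.monotone_sort (fun j => -hG.eigenvalues j) hij
    simp only [Function.comp_apply] at this
    linarith
  · refine ⟨U.submatrix id e, ?_, ?_⟩
    · have : (U.submatrix id e)ᵀ * U.submatrix id e = (Uᵀ * U).submatrix e e := by
        ext i j
        simp [Matrix.mul_apply]
      rw [this, h1]
      exact submatrix_one_equiv e
    · have hS : U.submatrix id e * diagonal (svalsDesc K) * (U.submatrix id e)ᵀ =
          U * diagonal (fun i => Real.sqrt (hG.eigenvalues i)) * Uᵀ := by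
        ext i j
        rw [hs]
        rw [Matrix.mul_apply, Matrix.mul_apply]
        simp only [mul_diagonal, submatrix_apply, transpose_apply, id]
        exact Equiv.sum_comp e (fun x => U i x * √(hG.eigenvalues x) * U j x)
      rw [hS]
      apply psd_sqrt_unique _ _ hK
      · have := (PosSemidef.diagonal (d := fun i => Real.sqrt (hG.eigenvalues i))
          (fun i => Real.sqrt_nonneg _)).mul_mul_conjTranspose_same U
        rwa [conjTranspose_eq_transpose_of_trivial] at this
      · calc K * K = Kᵀ * K := by rw [hKs]
          _ = U * diagonal hG.eigenvalues * Uᵀ := h2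
          _ = U * diagonal (fun i => √(hG.eigenvalues i)) * (Uᵀ * U) *
              diagonal (fun i => √(hG.eigenvalues i)) * Uᵀ := by
            rw [h1, Matrix.mul_one, Matrix.mul_assoc U (diagonal _) (diagonal _),
              diagonal_mul_diagonal]
            congr 3
            ext i
            rw [Real.mul_self_sqrt (hpsd.eigenvalues_nonneg i)]
          _ = _ := by simp only [Matrix.mul_assoc]

/-- Weighted tail inequality. -/
lemma tail_ineq {n k : ℕ} (hkn : k < n) (s : Fin n → ℝ) (hs : Antitone s) (w : Fin n → ℝ)
    (w0 : ∀ i, 0 ≤ w i) (w1 : ∀ i, w i ≤ 1) (r : ℝ) (hw : ∑ i, w i = (n : ℝ) - r) (hr : r ≤ k)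
    (δ : ℝ) (hδ : δ * ((n : ℝ) - k) = ∑ i, s i - ∑ j : Fin k, s (Fin.castLE hkn.le j)) :
    δ * ((n : ℝ) - r) ≤ ∑ i, w i * s i := by
  set m : Fin n := ⟨k, hkn⟩
  have ind : ∀ f : Fin n → ℝ, ∑ i, (if i < m then f i else 0) =
      ∑ j : Fin k, f (Fin.castLE hkn.le j) := by
    intro f
    rw [← Finset.sum_filter]
    symm
    refine Finset.sum_bij (fun j _ => Fin.castLE hkn.le j) ?_ ?_ ?_ ?_
    · intro a _; simp [m, Fin.lt_def]
    · intro a _ b _ h; simpa using h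
    · intro b hb
      simp [m, Fin.lt_def] at hb
      exact ⟨⟨b, hb⟩, by simp, by ext; simp⟩
    · intros; rfl
  have i1 := ind (fun _ => 1)
  have i2 := ind s
  simp only [Finset.sum_const, Finset.card_univ, Fintype.card_fin, nsmul_eq_mul, mul_one] at i1
  have hsm : δ ≤ s m := by
    have : (0:ℝ) < (n:ℝ) - k := by
      have : (k:ℝ) < n := by exact_mod_cast hkn
      linarith
    refine le_of_mul_le_mul_right ?_ this
    have h : ∀ i, s i - (if i < m then s i else 0) ≤ s m * (1 - if i < m then 1 else 0) := by
      intro i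
      split_ifs with hi
      · simp
      · simpa using hs (not_lt.1 hi)
    have h' := Finset.sum_le_sum fun i (_ : i ∈ Finset.univ) => h i
    rw [Finset.sum_sub_distrib, ← Finset.mul_sum, Finset.sum_sub_distrib, i1, i2] at h'
    simp at h'
    linarith
  have h : ∀ i, 0 ≤ (w i - 1 + if i < m then 1 else 0) * (s i - s m) := by
    intro i
    split_ifs with hi
    · exact mul_nonneg (by linarith [w0 i]) (by linarith [hs hi.le])
    · exact mul_nonneg_of_nonpos_of_nonpos (by linarith [w1 i]) (by linarith [hs (not_lt.1 hi)])
  have h' := Finset.sum_nonneg fun i (_ : i ∈ Finset.univ) => h i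
  have e : ∀ i, (w i - 1 + if i < m then 1 else 0) * (s i - s m) =
      w i * s i - s i + (if i < m then s i else 0) - s m * w i + s m
        - s m * (if i < m then 1 else 0) := by
    intro i; split_ifs <;> ring
  simp only [e, Finset.sum_sub_distrib, Finset.sum_add_distrib, ← Finset.mul_sum, i1, i2, hw] at h'
  simp at h'
  nlinarith [mul_le_mul_of_nonneg_right hsm (sub_nonneg.2 hr)]

lemma trace_tail {n k : ℕ} (hkn : k < n) (K R : Matrix (Fin n) (Fin n) ℝ) (hK : K.PosSemidef)
    (hs : Rᵀ = R) (hi : R * R = R) (r : ℝ) (hR : R.trace = n - r) (hr : r ≤ k) (δ : ℝ)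
    (hδ : δ = (K.trace - ∑ j : Fin k, svalsDesc K (Fin.castLE hkn.le j)) / ((n : ℝ) - k)) :
    δ * ((n : ℝ) - r) ≤ (R * K).trace := by
  obtain ⟨ha, V, hV, hKV⟩ := svd_psd K hK
  have hV' : V * Vᵀ = 1 := mul_eq_one_comm.1 hV
  have pos : (0:ℝ) < (n:ℝ) - k := by
    have : (k:ℝ) < n := by exact_mod_cast hkn
    linarith
  set s := svalsDesc K
  have t1 : K.trace = ∑ i, s i := by
    rw [hKV, Matrix.trace_mul_comm, ← Matrix.mul_assoc, hV, Matrix.one_mul, trace_diagonal]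
  set W := Vᵀ * R * V with hW
  have t2 : (R * K).trace = ∑ i, W i i * s i := by
    rw [hKV, ← Matrix.mul_assoc, Matrix.trace_mul_comm, ← Matrix.mul_assoc, ← Matrix.mul_assoc,
      ← hW]
    simp [Matrix.trace, mul_diagonal]
  have t3 : ∑ i, W i i = n - r := by
    rw [← hR]
    change W.trace = _
    rw [hW, Matrix.trace_mul_comm, ← Matrix.mul_assoc, hV', Matrix.one_mul]
  have diag : ∀ R : Matrix (Fin n) (Fin n) ℝ, Rᵀ = R → R * R = R →
      ∀ i, 0 ≤ (Vᵀ * R * V) i i := by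
    intro R hs hi i
    have : Vᵀ * R * V = (R * V)ᵀ * (R * V) := by
      rw [transpose_mul, hs, Matrix.mul_assoc Vᵀ R (R * V), ← Matrix.mul_assoc R R, hi,
        Matrix.mul_assoc]
    rw [this, Matrix.mul_apply]
    exact Finset.sum_nonneg fun j _ => by simpa using mul_self_nonneg _
  rw [t2]
  refine tail_ineq hkn s ha _ (diag R hs hi) ?_ r t3 hr δ ?_
  · intro i
    obtain ⟨a, b⟩ := compl_proj R hs hi
    have := diag (1 - R) a b i
    rw [Matrix.mul_sub, Matrix.sub_mul, Matrix.mul_one, hV] at this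
    simp at this
    exact this
  · rw [hδ, t1]; field_simp

lemma frobSq_sub_smul {n : ℕ} (M R : Matrix (Fin n) (Fin n) ℝ) (hs : Rᵀ = R) (hi : R * R = R)
    (x : ℝ) : frobSq (M - x • R) = frobSq M - 2 * x * (M * R).trace + x ^ 2 * R.trace := by
  have e : (R * M).trace = (M * R).trace := Matrix.trace_mul_comm _ _
  have e' : (Mᵀ * R).trace = (M * R).trace := by
    rw [← trace_transpose, transpose_mul, transpose_transpose, hs, e]
  rw [frobSq_eq, frobSq_eq, transpose_sub, transpose_smul, hs]
  simp only [Matrix.sub_mul, Matrix.mul_sub, Matrix.smul_mul, Matrix.mul_smul, trace_sub,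
    trace_smul, hi, e, e', smul_eq_mul]
  ring

end SpecShift

/-- The spectral shifting model inherits (and improves) the error
bound of the prototype model, for any initial shift `δ̃ ∈ (0, δ̄]`. -/
theorem spectral_shifting_inherits_bound {n k c : ℕ} (hkn : k < n) {η : ℝ} (hη : 0 < η)
    (P : Matrix (Fin n) (Fin c) ℝ)
    (hP : ∀ (A Ak : Matrix (Fin n) (Fin n) ℝ), A.IsSymm → IsBestRankApprox A Ak k →
        frobSq (A - (A * P) * pinv (A * P) * A * (pinv (A * P))ᵀ * (A * P)ᵀ) ≤
          η * frobSq (A - Ak))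
    (K : Matrix (Fin n) (Fin n) ℝ) (hK : K.PosSemidef)
    (δbar : ℝ)
    (hδbar : δbar = (K.trace - ∑ j : Fin k, svalsDesc K (Fin.castLE hkn.le j)) / ((n : ℝ) - k))
    (δtil : ℝ) (hδ0 : 0 < δtil) (hδ1 : δtil ≤ δbar)
    (Kbar : Matrix (Fin n) (Fin n) ℝ) (hKbar : Kbar = K - δtil • (1 : Matrix (Fin n) (Fin n) ℝ))
    (Cbar : Matrix (Fin n) (Fin c) ℝ) (hCbar : Cbar = Kbar * P) (hrank : Cbar.rank < n)
    (δss : ℝ) (hδss : δss = (K.trace - (pinv Cbar * K * Cbar).trace) / ((n : ℝ) - Cbar.rank))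
    (Uss : Matrix (Fin c) (Fin c) ℝ)
    (hUss : Uss = pinv Cbar * K * (pinv Cbar)ᵀ - δss • pinv (Cbarᵀ * Cbar))
    (Ktil : Matrix (Fin n) (Fin n) ℝ)
    (hKtil : Ktil = Cbar * Uss * Cbarᵀ + δss • (1 : Matrix (Fin n) (Fin n) ℝ))
    (Kbark Kk : Matrix (Fin n) (Fin n) ℝ)
    (hKbark : IsBestRankApprox Kbar Kbark k) (hKk : IsBestRankApprox K Kk k) :
    frobSq (K - Ktil) ≤ η * frobSq (Kbar - Kbark) ∧
      η * frobSq (Kbar - Kbark) ≤ η * frobSq (K - Kk) := by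
  have hKs : Kᵀ = K := by
    have := hK.1
    rwa [IsHermitian, conjTranspose_eq_transpose_of_trivial] at this
  have hKbs : Kbarᵀ = Kbar := by rw [hKbar]; simp [hKs]
  constructor
  · refine le_trans ?_ (hP Kbar Kbark hKbs hKbark)
    rw [← hCbar]
    obtain ⟨c1, c2, c3, -⟩ := SpecShift.pinv_spec Cbar
    have htr := SpecShift.trace_proj Cbar
    have hg := SpecShift.gram_proj Cbar
    have hQi : (Cbar * pinv Cbar) * (Cbar * pinv Cbar) = Cbar * pinv Cbar := by
      rw [← Matrix.mul_assoc, c1]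
    have hct : (pinv Cbar * K * Cbar).trace = (K * (Cbar * pinv Cbar)).trace := by
      rw [Matrix.mul_assoc, Matrix.trace_mul_comm, Matrix.mul_assoc]
    have hq : ∀ A : Matrix (Fin n) (Fin n) ℝ,
        Cbar * pinv Cbar * A * (pinv Cbar)ᵀ * Cbarᵀ =
          (Cbar * pinv Cbar) * A * (Cbar * pinv Cbar) := by
      intro A
      rw [Matrix.mul_assoc _ (pinv Cbar)ᵀ, ← transpose_mul, c3]
    have hU : Cbar * Uss * Cbarᵀ =
        (Cbar * pinv Cbar) * K * (Cbar * pinv Cbar) - δss • (Cbar * pinv Cbar) := by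
      rw [hUss, Matrix.mul_sub, Matrix.sub_mul, ← hq K, Matrix.mul_smul, Matrix.smul_mul, hg]
      simp only [Matrix.mul_assoc]
    rw [hq, hKtil, hU]
    rw [hct] at hδss
    generalize Cbar * pinv Cbar = Q at *
    obtain ⟨r1, r2⟩ := SpecShift.compl_proj Q c3 hQi
    have E1 : K - (Q * K * Q - δss • Q + δss • (1 : Matrix (Fin n) (Fin n) ℝ)) =
        (K - Q * K * Q) - δss • (1 - Q) := by
      rw [smul_sub]; abel
    have E2 : Kbar - Q * Kbar * Q = (K - Q * K * Q) - δtil • (1 - Q) := by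
      rw [hKbar]
      simp only [Matrix.mul_sub, Matrix.sub_mul, Matrix.mul_smul, Matrix.smul_mul, Matrix.mul_one,
        hQi, smul_sub]
      abel
    rw [E1, E2, SpecShift.frobSq_sub_smul _ _ r1 r2, SpecShift.frobSq_sub_smul _ _ r1 r2]
    have T : ((K - Q * K * Q) * (1 - Q)).trace = K.trace - (K * Q).trace := by
      have : (K - Q * K * Q) * (1 - Q) = K - K * Q := by
        rw [Matrix.mul_sub, Matrix.mul_one, Matrix.sub_mul K, Matrix.mul_assoc (Q * K) Q Q, hQi]
        simp
      rw [this, trace_sub]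
    have T2 : (1 - Q).trace = (n : ℝ) - Cbar.rank := by
      rw [trace_sub, htr]; simp
    have hpos : (0:ℝ) < (n : ℝ) - Cbar.rank := by
      have : (Cbar.rank : ℝ) < n := by exact_mod_cast hrank
      linarith
    rw [T, T2]
    have hδ : K.trace - (K * Q).trace = δss * ((n : ℝ) - Cbar.rank) := by
      rw [hδss]; field_simp
    rw [hδ]
    nlinarith [mul_nonneg hpos.le (sq_nonneg (δss - δtil))]
  · refine mul_le_mul_of_nonneg_left ?_ hη.le
    obtain ⟨c1, c2, c3, -⟩ := SpecShift.pinv_spec Kk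
    have htr := SpecShift.trace_proj Kk
    have hQi : (Kk * pinv Kk) * (Kk * pinv Kk) = Kk * pinv Kk := by
      rw [← Matrix.mul_assoc, c1]
    have hrk : (Kk * pinv Kk * Kbar).rank ≤ k := by
      rw [Matrix.mul_assoc]
      exact (rank_mul_le_left _ _).trans hKk.1
    generalize Kk * pinv Kk = Q at *
    obtain ⟨r1, r2⟩ := SpecShift.compl_proj Q c3 hQi
    have T2 : (1 - Q).trace = (n : ℝ) - Kk.rank := by
      rw [trace_sub, htr]; simp
    have hr : (Kk.rank : ℝ) ≤ k := by exact_mod_cast hKk.1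
    have hkn' : (k : ℝ) < n := by exact_mod_cast hkn
    have tt := SpecShift.trace_tail hkn K (1 - Q) hK r1 r2 _ T2 hr δbar hδbar
    have L : frobSq ((1 - Q) * K) ≤ frobSq (K - Kk) := by
      have : (1 - Q) * K = (1 - Q) * (K - Kk) := by
        simp only [Matrix.mul_sub, Matrix.sub_mul, Matrix.one_mul, c1]
        abel
      rw [this]
      exact SpecShift.frobSq_proj_le _ _ r1 r2
    refine le_trans (hKbark.2 _ hrk) (le_trans ?_ L)
    have e : Kbar - Q * Kbar = (1 - Q) * K - δtil • (1 - Q) := by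
      rw [hKbar]
      simp only [Matrix.mul_sub, Matrix.sub_mul, Matrix.mul_smul, Matrix.one_mul,
        Matrix.mul_one, smul_sub]
      abel
    rw [e, SpecShift.frobSq_sub_smul _ _ r1 r2]
    have e3 : ((1 - Q) * K * (1 - Q)).trace = ((1 - Q) * K).trace := by
      rw [Matrix.trace_mul_comm, ← Matrix.mul_assoc, r2]
    rw [e3, T2]
    have hp : (0:ℝ) < (n : ℝ) - Kk.rank := by linarith
    have h1 : δtil * ((n : ℝ) - Kk.rank) ≤ ((1 - Q) * K).trace :=
      (mul_le_mul_of_nonneg_right hδ1 hp.le).trans tt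
    nlinarith [mul_le_mul_of_nonneg_left h1 hδ0.le, mul_nonneg hδ0.le (mul_nonneg hδ0.le hp.le)]
end
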